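/- arXiv:1608.01597 — 3 statements merged into one kernel-verified Lean document; each statement's English description precedes it below -/
import Mathlib

section
/- Fix β > 0, set θ = β/2, and let k ≥ 1. Let p be a symmetric polynomial in k real variables. Then there exists a symmetric polynomial q in k+1 real variables such that: (i) for every strictly increasing x = (x_1 < x_2 < … < x_{k+1}) ∈ ℝ^{k+1}, q(x) = ∫_{W^{(k)}(x)} Λ^{(k)}(x,y) p(y) dy; and (ii) for every such x, (Ã^{(k+1)}q)(x) = ∫_{W^{(k)}(x)} Λ^{(k)}(x,y) (Ã^{(k)}p)(y) dy, where Ã^{(m)} := A^{(m)} − (1/2) Σ_{i=1}^m z_i ∂/∂z_i is the generator of the m-dimensional β-Dyson Ornstein–Uhlenbeck process and (Ã^{(k)}p)(y) is defined at all y with pairwise distinct coordinates, hence Lebesgue-almost everywhere on W^{(k)}(x). -/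
open Finset MeasureTheory

/-- First-order partial derivative `∂f/∂z_i (z)`. -/
noncomputable def pd {m : ℕ} (f : (Fin m → ℝ) → ℝ) (i : Fin m) (z : Fin m → ℝ) : ℝ :=
  fderiv ℝ f z (Pi.single i 1)

/-- Second-order partial derivative `∂²f/∂z_i² (z)`. -/
noncomputable def pd2 {m : ℕ} (f : (Fin m → ℝ) → ℝ) (i : Fin m) (z : Fin m → ℝ) : ℝ :=
  fderiv ℝ (fun w => fderiv ℝ f w (Pi.single i 1)) z (Pi.single i 1)

/-- The generator `A^{(m)}` of the `m`-dimensional `β`-Dyson Brownian motion, with `θ = β/2`: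
`(A^{(m)}f)(z) = (1/2) Σ_i ∂²f/∂z_i²(z) + θ Σ_i Σ_{j≠i} (1/(z_i-z_j)) ∂f/∂z_i(z)`. -/
noncomputable def genA {m : ℕ} (θ : ℝ) (f : (Fin m → ℝ) → ℝ) (z : Fin m → ℝ) : ℝ :=
  (1 / 2) * ∑ i, pd2 f i z +
    θ * ∑ i, ∑ j ∈ univ.erase i, (1 / (z i - z j)) * pd f i z

/-- The interlacing domain `W^{(k)}(x) = {y : x_1 ≤ y_1 ≤ x_2 ≤ y_2 ≤ … ≤ y_k ≤ x_{k+1}}`. -/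
def DAdomain (k : ℕ) (x : Fin (k + 1) → ℝ) : Set (Fin k → ℝ) :=
  {y | ∀ i : Fin k, x i.castSucc ≤ y i ∧ y i ≤ x i.succ}

/-- The Dixon–Anderson conditional probability density `Λ^{(k)}(x,y)` with parameter `β`. -/
noncomputable def DAdensity (k : ℕ) (β : ℝ) (x : Fin (k + 1) → ℝ) (y : Fin k → ℝ) : ℝ :=
  (Real.Gamma (β * (k + 1) / 2) / Real.Gamma (β / 2) ^ (k + 1)) *
    (∏ i : Fin (k + 1), ∏ j ∈ Ioi i, (x j - x i) ^ (1 - β)) *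
    (∏ i : Fin k, ∏ j ∈ Ioi i, (y j - y i)) *
    (∏ i : Fin k, ∏ j : Fin (k + 1), |y i - x j| ^ (β / 2 - 1))

/-- The generator `Ã^{(m)} = A^{(m)} - (1/2) Σ_i z_i ∂/∂z_i` of the `m`-dimensional
`β`-Dyson Ornstein–Uhlenbeck process, with `θ = β/2`. -/
noncomputable def genOU {m : ℕ} (θ : ℝ) (f : (Fin m → ℝ) → ℝ) (z : Fin m → ℝ) : ℝ :=
  genA θ f z - (1 / 2) * ∑ i, z i * pd f i z


noncomputable def PP {n : ℕ} (x : Fin n → ℝ) (s : Finset (Fin n)) (z : ℝ) : ℝ :=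
  ∏ i ∈ s, (z - x i)

lemma PP_erase {n : ℕ} (x : Fin n → ℝ) (s : Finset (Fin n)) (z : ℝ) {i : Fin n} (hi : i ∈ s) :
    PP x s z = (z - x i) * PP x (s.erase i) z := by
  unfold PP; rw [Finset.mul_prod_erase s (fun i => z - x i) hi]

lemma PP_sub {n : ℕ} (x : Fin n → ℝ) (s : Finset (Fin n)) (z : ℝ) {i m : Fin n} (hi : i ∈ s)
    (hm : m ∈ s) (h : i ≠ m) :
    PP x (s.erase i) z - PP x (s.erase m) z = (x i - x m) * PP x ((s.erase i).erase m) z := by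
  rw [PP_erase x (s.erase i) z (i := m) (by simp [hm, h.symm]),
    PP_erase x (s.erase m) z (i := i) (by simp [hi, h]), Finset.erase_right_comm (s := s) (a := m)]
  ring

/-- symmetrisation -/
lemma sym_drift {n : ℕ} (x : Fin n → ℝ) (hx : Function.Injective x) (s : Finset (Fin n)) (z : ℝ) :
    ∑ i ∈ s, ∑ m ∈ s.erase i, 1 / (x i - x m) * PP x (s.erase i) z
      = (1 / 2) * ∑ i ∈ s, ∑ m ∈ s.erase i, PP x ((s.erase i).erase m) z := by
  have swap : ∀ f : Fin n → Fin n → ℝ, ∑ i ∈ s, ∑ m ∈ s.erase i, f i m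
      = ∑ i ∈ s, ∑ m ∈ s.erase i, f m i := by
    intro f
    rw [Finset.sum_comm' (s' := fun m => s.erase m) (t' := s)]
    intro a b; simp only [mem_erase]; tauto
  have h2 : ∑ i ∈ s, ∑ m ∈ s.erase i, 1 / (x i - x m) * PP x (s.erase i) z
      + ∑ i ∈ s, ∑ m ∈ s.erase i, 1 / (x i - x m) * PP x (s.erase i) z
      = ∑ i ∈ s, ∑ m ∈ s.erase i, PP x ((s.erase i).erase m) z := by
    conv_lhs => arg 2; rw [swap]
    rw [← Finset.sum_add_distrib]
    refine Finset.sum_congr rfl fun i hi => ?_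
    rw [← Finset.sum_add_distrib]
    refine Finset.sum_congr rfl fun m hm => ?_
    have hm' := Finset.mem_erase.1 hm
    have hne : x i - x m ≠ 0 := sub_ne_zero.2 fun h => hm'.1 (hx h).symm
    have hne' : x m - x i ≠ 0 := sub_ne_zero.2 fun h => hm'.1 (hx h)
    have := PP_sub x s z hi hm'.2 (Ne.symm hm'.1)
    have e : PP x (s.erase i) z = PP x (s.erase m) z + (x i - x m) * PP x ((s.erase i).erase m) z := by
      linarith
    rw [e]
    have : 1 / (x m - x i) = - (1 / (x i - x m)) := by
      rw [← neg_sub, div_neg]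
    rw [this]
    field_simp
    ring
  linarith

/-- the polynomial version -/
noncomputable def PX {n : ℕ} (x : Fin n → ℝ) (s : Finset (Fin n)) : Polynomial ℝ :=
  ∏ i ∈ s, (Polynomial.X - Polynomial.C (x i))

lemma PX_eval {n : ℕ} (x : Fin n → ℝ) (s : Finset (Fin n)) (z : ℝ) :
    (PX x s).eval z = PP x s z := by
  simp [PX, PP, Polynomial.eval_prod]

lemma PX_deriv {n : ℕ} (x : Fin n → ℝ) (s : Finset (Fin n)) :
    Polynomial.derivative (PX x s) = ∑ i ∈ s, PX x (s.erase i) := by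
  unfold PX
  rw [Polynomial.derivative_prod_finset]
  simp

lemma PX_natDegree {n : ℕ} (x : Fin n → ℝ) (s : Finset (Fin n)) :
    (PX x s).natDegree = s.card := by
  simp [PX]

lemma PX_monic {n : ℕ} (x : Fin n → ℝ) (s : Finset (Fin n)) :
    (PX x s).Monic := Polynomial.monic_prod_X_sub_C _ _

/-- Dixon–Anderson weights -/
noncomputable def DAw {k : ℕ} (x : Fin (k + 1) → ℝ) (y : Fin k → ℝ) (j : Fin (k + 1)) : ℝ :=
  PP y univ (x j) / PP x (univ.erase j) (x j)

lemma PP_self_ne {n : ℕ} (x : Fin n → ℝ) (hx : Function.Injective x) (j : Fin n) :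
    PP x (univ.erase j) (x j) ≠ 0 := by
  unfold PP
  refine Finset.prod_ne_zero_iff.2 fun i hi => sub_ne_zero.2 fun h => ?_
  exact (Finset.mem_erase.1 hi).1 (hx h).symm

lemma PP_zero_of_mem {n : ℕ} (x : Fin n → ℝ) (s : Finset (Fin n)) (j : Fin n) (h : j ∈ s) :
    PP x s (x j) = 0 := by
  unfold PP
  exact Finset.prod_eq_zero h (sub_self _)

/-- if a polynomial of degree `≤ k` takes the values `u j * P_j(x_j)`, it is `∑ u_j P_j`. -/
lemma interp {k : ℕ} (x : Fin (k + 1) → ℝ) (hx : Function.Injective x) (p : Polynomial ℝ)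
    (hp : p.natDegree ≤ k) (u : Fin (k + 1) → ℝ)
    (hu : ∀ j, p.eval (x j) = u j * PP x (univ.erase j) (x j)) :
    p = ∑ j, Polynomial.C (u j) * PX x (univ.erase j) := by
  have hinj : Set.InjOn x (univ : Finset (Fin (k+1))) := hx.injOn
  refine Polynomial.eq_of_degrees_lt_of_eval_index_eq (s := (univ : Finset (Fin (k+1)))) (v := x) hinj ?_ ?_ ?_
  · refine lt_of_le_of_lt Polynomial.degree_le_natDegree ?_
    simp; exact_mod_cast Nat.lt_succ_of_le hp
  · refine lt_of_le_of_lt (Polynomial.degree_sum_le _ _) ?_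
    rw [Finset.sup_lt_iff (by simp)]
    intro j _
    refine lt_of_le_of_lt Polynomial.degree_le_natDegree ?_
    have := Polynomial.natDegree_C_mul_le (u j) (PX x (univ.erase j))
    rw [PX_natDegree] at this
    simp at this
    simp
    exact_mod_cast Nat.lt_succ_of_le this
  · intro j _
    rw [hu, Polynomial.eval_finsetSum, Finset.sum_eq_single j]
    · simp [PX_eval]
    · intro b _ hb
      simp [PX_eval]
      right
      exact PP_zero_of_mem x _ j (by simp [hb.symm])
    · simp

lemma DAw_poly {k : ℕ} (x : Fin (k + 1) → ℝ) (hx : Function.Injective x) (y : Fin k → ℝ) :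
    PX y univ = ∑ j, Polynomial.C (DAw x y j) * PX x (univ.erase j) := by
  refine interp x hx _ (by rw [PX_natDegree]; simp) _ fun j => ?_
  rw [PX_eval, DAw, div_mul_cancel₀ _ (PP_self_ne x hx j)]

lemma DAw_id0 {k : ℕ} (x : Fin (k + 1) → ℝ) (hx : Function.Injective x) (y : Fin k → ℝ) (z : ℝ) :
    PP y univ z = ∑ j, DAw x y j * PP x (univ.erase j) z := by
  have := congrArg (Polynomial.eval z) (DAw_poly x hx y)
  simpa [PX_eval, Polynomial.eval_finsetSum] using this

lemma DAw_id1 {k : ℕ} (x : Fin (k + 1) → ℝ) (hx : Function.Injective x) (y : Fin k → ℝ) (z : ℝ) :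
    ∑ i, PP y (univ.erase i) z
      = ∑ j, DAw x y j * ∑ i ∈ univ.erase j, PP x ((univ.erase j).erase i) z := by
  have := congrArg (fun p => Polynomial.eval z (Polynomial.derivative p)) (DAw_poly x hx y)
  simpa [PX_eval, Polynomial.eval_finsetSum, PX_deriv] using this

lemma DAw_id2 {k : ℕ} (x : Fin (k + 1) → ℝ) (hx : Function.Injective x) (y : Fin k → ℝ) (z : ℝ) :
    ∑ i, ∑ m ∈ univ.erase i, PP y ((univ.erase i).erase m) z
      = ∑ j, DAw x y j * ∑ i ∈ univ.erase j, ∑ m ∈ (univ.erase j).erase i,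
          PP x (((univ.erase j).erase i).erase m) z := by
  have := congrArg (fun p => Polynomial.eval z (Polynomial.derivative (Polynomial.derivative p)))
    (DAw_poly x hx y)
  simpa [PX_eval, Polynomial.eval_finsetSum, PX_deriv] using this

lemma sum_erase_swap {n : ℕ} {A : Type*} [AddCommMonoid A] (f : Fin n → Fin n → A) :
    ∑ i, ∑ j ∈ univ.erase i, f i j = ∑ j, ∑ i ∈ univ.erase j, f i j := by
  rw [Finset.sum_comm' (s' := fun m => univ.erase m) (t' := univ)]
  intro a b; simp only [mem_erase, mem_univ, and_true, true_and]; exact ne_comm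

/-- `D_i(z) = ∑_{j≠i} w_j P_{ij}(z)` -/
noncomputable def DD {n : ℕ} (x w : Fin n → ℝ) (i : Fin n) (z : ℝ) : ℝ :=
  ∑ j ∈ univ.erase i, w j * PP x ((univ.erase j).erase i) z

lemma DD_mul {n : ℕ} (x w : Fin n → ℝ) (i : Fin n) (z : ℝ) :
    (z - x i) * DD x w i z = (∑ j, w j * PP x (univ.erase j) z) - w i * PP x (univ.erase i) z := by
  rw [← Finset.add_sum_erase univ _ (mem_univ i), add_sub_cancel_left, DD, Finset.mul_sum]
  refine Finset.sum_congr rfl fun j hj => ?_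
  rw [PP_erase x (univ.erase j) z (i := i) (by simp; exact (Finset.mem_erase.1 hj).1.symm)]
  ring

lemma DD_sum {n : ℕ} (x w : Fin n → ℝ) (z : ℝ) :
    ∑ i, DD x w i z = ∑ j, w j * ∑ i ∈ univ.erase j, PP x ((univ.erase j).erase i) z := by
  unfold DD
  rw [sum_erase_swap]
  simp_rw [Finset.mul_sum]

lemma euler_id {k : ℕ} (x : Fin (k + 1) → ℝ) (hx : Function.Injective x) (y : Fin k → ℝ) (z : ℝ) :
    ∑ i, y i * PP y (univ.erase i) z = ∑ i, x i * DD x (DAw x y) i z := by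
  have h1 : ∑ i, (z - y i) * PP y (univ.erase i) z = k * PP y univ z := by
    rw [Finset.sum_congr rfl fun i _ => (PP_erase y univ z (mem_univ i)).symm]; simp
  have h2 : ∑ i, (z - x i) * DD x (DAw x y) i z = k * PP y univ z := by
    simp_rw [DD_mul, ← DAw_id0 x hx y z]
    rw [Finset.sum_sub_distrib, ← DAw_id0 x hx y z]; simp; ring
  have h3 := DAw_id1 x hx y z
  rw [← DD_sum] at h3
  simp_rw [sub_mul, Finset.sum_sub_distrib, ← Finset.mul_sum] at h1 h2
  rw [← h3] at h2
  linarith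

lemma gamma_id {k : ℕ} (x : Fin (k + 1) → ℝ) (hx : Function.Injective x) (y : Fin k → ℝ)
    (z t : ℝ) :
    ∑ i, PP y (univ.erase i) z * PP y (univ.erase i) t
      = ∑ i, DD x (DAw x y) i z * DD x (DAw x y) i t
        + ∑ j, ∑ l ∈ univ.erase j, DAw x y j * DAw x y l *
          (PP x ((univ.erase j).erase l) z * PP x ((univ.erase j).erase l) t) := by
  set w := DAw x y with hw
  have key : ∀ z, z ≠ t → ∑ i, PP y (univ.erase i) z * PP y (univ.erase i) t
      = ∑ i, DD x w i z * DD x w i t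
        + ∑ j, ∑ l ∈ univ.erase j, w j * w l *
          (PP x ((univ.erase j).erase l) z * PP x ((univ.erase j).erase l) t) := by
    intro z hz
    have hz' : z - t ≠ 0 := sub_ne_zero.2 hz
    apply mul_left_cancel₀ hz'
    have e1 : (z - t) * ∑ i, PP y (univ.erase i) z * PP y (univ.erase i) t
        = PP y univ z * (∑ i, DD x w i t) - (∑ i, DD x w i z) * PP y univ t := by
      rw [DD_sum, DD_sum, ← DAw_id1 x hx y, ← DAw_id1 x hx y, Finset.mul_sum, Finset.mul_sum,
        Finset.sum_mul, ← Finset.sum_sub_distrib]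
      refine Finset.sum_congr rfl fun i _ => ?_
      rw [PP_erase y univ z (mem_univ i), PP_erase y univ t (mem_univ i)]
      ring
    have e2 : (z - t) * ∑ i, DD x w i z * DD x w i t
        = PP y univ z * (∑ i, DD x w i t) - (∑ i, DD x w i z) * PP y univ t
          - ∑ i, w i * (PP x (univ.erase i) z * DD x w i t - DD x w i z * PP x (univ.erase i) t) := by
      rw [Finset.mul_sum, Finset.mul_sum, Finset.sum_mul, ← Finset.sum_sub_distrib,
        ← Finset.sum_sub_distrib]
      refine Finset.sum_congr rfl fun i _ => ?_
      have a1 := DD_mul x w i z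
      have a2 := DD_mul x w i t
      rw [← DAw_id0 x hx y] at a1 a2
      linear_combination DD x w i t * a1 - DD x w i z * a2
    have e3 : (z - t) * ∑ j, ∑ l ∈ univ.erase j, w j * w l *
          (PP x ((univ.erase j).erase l) z * PP x ((univ.erase j).erase l) t)
        = ∑ i, w i * (PP x (univ.erase i) z * DD x w i t - DD x w i z * PP x (univ.erase i) t) := by
      rw [Finset.mul_sum]
      refine Finset.sum_congr rfl fun j _ => ?_
      unfold DD
      rw [Finset.mul_sum, Finset.mul_sum, Finset.sum_mul, ← Finset.sum_sub_distrib, Finset.mul_sum]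
      refine Finset.sum_congr rfl fun l hl => ?_
      rw [PP_erase x (univ.erase j) z hl, PP_erase x (univ.erase j) t hl,
        Finset.erase_right_comm (s := univ) (a := l)]
      ring
    rw [mul_add, e1, e2, e3]; ring
  have c : ∀ (n : ℕ) (x : Fin n → ℝ) s, Continuous (fun z => PP x s z) := by
    intro n x s; unfold PP; fun_prop
  have c2 : ∀ i, Continuous (fun z => DD x w i z) := by
    intro i; unfold DD
    exact continuous_finsetSum _ fun j _ => continuous_const.mul (c _ _ _)
  have hd : Dense {z : ℝ | z ≠ t} := dense_compl_singleton t
  have := Continuous.ext_on hd (f := fun z => ∑ i, PP y (univ.erase i) z * PP y (univ.erase i) t)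
    (g := fun z => ∑ i, DD x w i z * DD x w i t
        + ∑ j, ∑ l ∈ univ.erase j, w j * w l *
          (PP x ((univ.erase j).erase l) z * PP x ((univ.erase j).erase l) t))
    (continuous_finsetSum _ fun j _ => (c _ _ _).mul continuous_const)
    ((continuous_finsetSum _ fun j _ => (c2 _).mul continuous_const).add
      (continuous_finsetSum _ fun j _ => continuous_finsetSum _ fun l _ =>
        continuous_const.mul ((c _ _ _).mul continuous_const)))
    (fun z hz => key z hz)
  exact congrFun this z


lemma deriv_chain {α A : Type*} [Fintype α] [CommRing A] [Algebra ℝ A] (D : Derivation ℝ A A)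
    (M : α → A) (F : MvPolynomial α ℝ) :
    D (MvPolynomial.aeval M F)
      = ∑ a, MvPolynomial.aeval M (MvPolynomial.pderiv a F) * D (M a) := by
  classical
  induction F using MvPolynomial.induction_on with
  | C r => simp
  | add p q hp hq => simp [hp, hq, add_mul, Finset.sum_add_distrib]
  | mul_X p n hp =>
    simp only [map_mul, Derivation.leibniz, hp, MvPolynomial.aeval_X, smul_eq_mul, map_add,
      MvPolynomial.pderiv_X, add_mul, Finset.sum_add_distrib]
    congr 1
    · rw [Finset.sum_eq_single n]
      · simp
      · intro b _ hb; simp [hb.symm]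
      · simp
    · rw [Finset.mul_sum]
      exact Finset.sum_congr rfl fun a _ => by ring

lemma deriv_chain2 {α A : Type*} [Fintype α] [CommRing A] [Algebra ℝ A] (D : Derivation ℝ A A)
    (M : α → A) (hM : ∀ a, D (D (M a)) = 0) (F : MvPolynomial α ℝ) :
    D (D (MvPolynomial.aeval M F))
      = ∑ a, ∑ b, MvPolynomial.aeval M (MvPolynomial.pderiv b (MvPolynomial.pderiv a F))
          * (D (M a) * D (M b)) := by
  rw [deriv_chain, map_sum]
  refine Finset.sum_congr rfl fun a _ => ?_
  rw [Derivation.leibniz, hM, deriv_chain, smul_zero, zero_add]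
  simp only [smul_eq_mul, Finset.mul_sum]
  exact Finset.sum_congr rfl fun b _ => by ring

lemma hasFDerivAt_eval {n : ℕ} (Q : MvPolynomial (Fin n) ℝ) (z : Fin n → ℝ) :
    HasFDerivAt (fun z => MvPolynomial.eval z Q)
      (∑ i, MvPolynomial.eval z (MvPolynomial.pderiv i Q) •
        ContinuousLinearMap.proj (R := ℝ) (φ := fun _ : Fin n => ℝ) i) z := by
  classical
  induction Q using MvPolynomial.induction_on with
  | C r => simpa using hasFDerivAt_const _ _
  | add p q hp hq =>
    simp only [map_add, add_smul, Finset.sum_add_distrib]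
    exact hp.add hq
  | mul_X p m hp =>
    have h := hp.mul (hasFDerivAt_apply (𝕜 := ℝ) m z)
    simp only [map_mul, MvPolynomial.eval_X]
    refine h.congr_fderiv ?_
    simp only [Derivation.leibniz, map_add, smul_eq_mul, map_mul, MvPolynomial.eval_X,
      add_smul, Finset.sum_add_distrib, MvPolynomial.pderiv_X]
    congr 1
    · rw [Finset.sum_eq_single m]
      · simp
      · intro b _ hb; simp [hb.symm]
      · simp
    · rw [Finset.smul_sum]
      exact Finset.sum_congr rfl fun a _ => by rw [smul_smul]

lemma pd_eval {n : ℕ} (Q : MvPolynomial (Fin n) ℝ) (i : Fin n) (z : Fin n → ℝ) :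
    pd (fun z => MvPolynomial.eval z Q) i z = MvPolynomial.eval z (MvPolynomial.pderiv i Q) := by
  unfold pd
  rw [(hasFDerivAt_eval Q z).fderiv]
  simp [Pi.single_apply]

lemma pd2_eval {n : ℕ} (Q : MvPolynomial (Fin n) ℝ) (i : Fin n) (z : Fin n → ℝ) :
    pd2 (fun z => MvPolynomial.eval z Q) i z
      = MvPolynomial.eval z (MvPolynomial.pderiv i (MvPolynomial.pderiv i Q)) := by
  have : (fun w => fderiv ℝ (fun z => MvPolynomial.eval z Q) w (Pi.single i 1))
      = fun w => MvPolynomial.eval w (MvPolynomial.pderiv i Q) := by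
    funext w; exact pd_eval Q i w
  unfold pd2
  rw [this]
  exact pd_eval (MvPolynomial.pderiv i Q) i z

/-- formal version of `PP`. -/
noncomputable def LL {n : ℕ} {σ : Type*} (e : Fin n → σ) (s : Finset (Fin n)) (z : ℝ) :
    MvPolynomial σ ℝ := ∏ i ∈ s, (MvPolynomial.C z - MvPolynomial.X (e i))

lemma LL_eval {n : ℕ} {σ : Type*} (e : Fin n → σ) (s : Finset (Fin n)) (z : ℝ) (v : σ → ℝ) :
    MvPolynomial.eval v (LL e s z) = PP (v ∘ e) s z := by
  simp [LL, PP]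

lemma LL_pderiv {n : ℕ} {σ : Type*} (e : Fin n → σ) (he : Function.Injective e)
    (s : Finset (Fin n)) (z : ℝ) (i : Fin n) :
    MvPolynomial.pderiv (e i) (LL e s z) = if i ∈ s then - LL e (s.erase i) z else 0 := by
  classical
  have h0 : ∀ s : Finset (Fin n), i ∉ s → MvPolynomial.pderiv (e i) (LL e s z) = 0 := by
    intro s hs
    unfold LL
    refine Finset.prod_induction _ (fun p => MvPolynomial.pderiv (e i) p = 0) ?_ (by simp) ?_
    · intro a b ha hb
      rw [Derivation.leibniz, ha, hb]; simp
    · intro j hj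
      have : e j ≠ e i := fun h' => hs (he h' ▸ hj)
      rw [map_sub, MvPolynomial.pderiv_C, MvPolynomial.pderiv_X_of_ne this, sub_zero]
  split_ifs with hi
  · have : LL e s z = (MvPolynomial.C z - MvPolynomial.X (e i)) * LL e (s.erase i) z := by
      unfold LL
      rw [Finset.mul_prod_erase s (fun i => MvPolynomial.C z - MvPolynomial.X (e i)) hi]
    rw [this, Derivation.leibniz, h0 _ (by simp)]
    simp
  · exact h0 s hi

lemma LL_pderiv2 {n : ℕ} {σ : Type*} (e : Fin n → σ) (he : Function.Injective e)
    (s : Finset (Fin n)) (z : ℝ) (i : Fin n) :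
    MvPolynomial.pderiv (e i) (MvPolynomial.pderiv (e i) (LL e s z)) = 0 := by
  rw [LL_pderiv e he]
  split_ifs
  · rw [map_neg, LL_pderiv e he]; simp
  · simp

/-! the functional -/

noncomputable def wt {n : ℕ} (θ : ℝ) (f : Fin n → ℕ) : ℝ :=
  Real.Gamma (∑ _j : Fin n, θ) / (∏ _j : Fin n, Real.Gamma θ) *
    ((∏ j, Real.Gamma (θ + f j)) / Real.Gamma (∑ j, (θ + f j)))

noncomputable def EE {n : ℕ} (θ : ℝ) : MvPolynomial (Fin n) ℝ →ₗ[ℝ] ℝ :=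
  (MvPolynomial.basisMonomials (Fin n) ℝ).constr ℝ (fun m => wt θ m)

lemma EE_monomial {n : ℕ} (θ : ℝ) (m : Fin n →₀ ℕ) :
    EE θ (MvPolynomial.monomial m 1) = wt θ m := by
  have := (MvPolynomial.basisMonomials (Fin n) ℝ).constr_basis ℝ (fun m => wt θ m) m
  simpa [EE] using this

noncomputable def EX {n : ℕ} (θ : ℝ) :
    MvPolynomial (Fin n ⊕ Fin n) ℝ →ₗ[ℝ] MvPolynomial (Fin n) ℝ :=
  (MvPolynomial.basisMonomials (Fin n ⊕ Fin n) ℝ).constr ℝ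
    (fun m => MvPolynomial.monomial (Finsupp.equivFunOnFinite.symm fun i => m (Sum.inr i))
      (wt θ fun j => m (Sum.inl j)))

lemma EX_monomial {n : ℕ} (θ : ℝ) (m : Fin n ⊕ Fin n →₀ ℕ) (a : ℝ) :
    EX θ (MvPolynomial.monomial m a)
      = MvPolynomial.monomial (Finsupp.equivFunOnFinite.symm fun i => m (Sum.inr i))
      (a * wt θ fun j => m (Sum.inl j)) := by
  have := (MvPolynomial.basisMonomials (Fin n ⊕ Fin n) ℝ).constr_basis ℝ
    (fun m => MvPolynomial.monomial (Finsupp.equivFunOnFinite.symm fun i => m (Sum.inr i))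
      (wt θ fun j => m (Sum.inl j))) m
  have e : MvPolynomial.monomial m a = a • MvPolynomial.monomial m (1:ℝ) := by
    rw [MvPolynomial.smul_monomial]; simp
  rw [e, map_smul]
  unfold EX
  simp only [MvPolynomial.coe_basisMonomials] at this
  rw [this, MvPolynomial.smul_monomial]; simp

/-- substitute the `x`-variables. -/
noncomputable def evx {n : ℕ} (x : Fin n → ℝ) :
    MvPolynomial (Fin n ⊕ Fin n) ℝ →ₐ[ℝ] MvPolynomial (Fin n) ℝ :=
  MvPolynomial.aeval (Sum.elim MvPolynomial.X (fun i => MvPolynomial.C (x i)))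

lemma EX_eval {n : ℕ} (θ : ℝ) (x : Fin n → ℝ) (H : MvPolynomial (Fin n ⊕ Fin n) ℝ) :
    MvPolynomial.eval x (EX θ H) = EE θ (evx x H) := by
  induction H using MvPolynomial.induction_on' with
  | add p q hp hq => simp only [map_add, hp, hq]
  | monomial m a =>
    rw [EX_monomial, MvPolynomial.eval_monomial, evx, MvPolynomial.aeval_monomial]
    rw [Finsupp.prod_fintype _ _ (by simp), Finsupp.prod_fintype _ _ (by simp)]
    simp only [Fintype.prod_sum_type, Sum.elim_inl, Sum.elim_inr, ← map_pow, ← map_prod,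
      MvPolynomial.algebraMap_eq, Finsupp.equivFunOnFinite_symm_apply_apply]
    have : (∏ j, (MvPolynomial.X j : MvPolynomial (Fin n) ℝ) ^ m (Sum.inl j))
        = MvPolynomial.monomial (Finsupp.equivFunOnFinite.symm fun i => m (Sum.inl i)) 1 := by
      rw [MvPolynomial.monomial_eq, Finsupp.prod_fintype _ _ (by simp)]; simp
    rw [this, mul_comm (MvPolynomial.monomial _ _), ← MvPolynomial.smul_eq_C_mul,
      ← MvPolynomial.smul_eq_C_mul, map_smul, map_smul, EE_monomial]
    simp only [smul_eq_mul, Finsupp.coe_equivFunOnFinite_symm]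
    ring

lemma EX_pderiv {n : ℕ} (θ : ℝ) (i : Fin n) (H : MvPolynomial (Fin n ⊕ Fin n) ℝ) :
    MvPolynomial.pderiv i (EX θ H) = EX θ (MvPolynomial.pderiv (Sum.inr i) H) := by
  induction H using MvPolynomial.induction_on' with
  | add p q hp hq => simp only [map_add, hp, hq]
  | monomial m a =>
    rw [EX_monomial, MvPolynomial.pderiv_monomial, MvPolynomial.pderiv_monomial, EX_monomial]
    congr 1
    · congr 1
      ext j
      simp [Finsupp.single_apply]
    · simp
      ring

lemma wt_perm {n : ℕ} (θ : ℝ) (f : Fin n → ℕ) (σ : Equiv.Perm (Fin n)) :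
    wt θ (f ∘ σ) = wt θ f := by
  unfold wt
  simp only [Function.comp]
  rw [Equiv.prod_comp σ (fun j => Real.Gamma (θ + f j)), Equiv.sum_comp σ (fun j => θ + (f j:ℝ))]

lemma EX_rename {n : ℕ} (θ : ℝ) (σ : Equiv.Perm (Fin n)) (H : MvPolynomial (Fin n ⊕ Fin n) ℝ) :
    MvPolynomial.rename σ (EX θ H) = EX θ (MvPolynomial.rename (Equiv.sumCongr σ σ) H) := by
  induction H using MvPolynomial.induction_on' with
  | add p q hp hq => simp only [map_add, hp, hq]
  | monomial m a =>
    rw [EX_monomial, MvPolynomial.rename_monomial, MvPolynomial.rename_monomial, EX_monomial]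
    congr 1
    · congr 1
      ext j
      rw [Finsupp.mapDomain_equiv_apply]
      simp [Finsupp.mapDomain_equiv_apply]
    · congr 1
      rw [← wt_perm θ _ σ.symm]
      congr 1
      ext j
      simp [Finsupp.mapDomain_equiv_apply]

lemma wt_succ {n : ℕ} (θ : ℝ) (hθ : 0 < θ) (f : Fin n → ℕ) (l : Fin n) :
    wt θ (f + Pi.single l 1) = wt θ f * ((θ + f l) / ∑ j, (θ + f j)) := by
  unfold wt
  have h1 : ∑ j, (θ + (((f + Pi.single l 1 : Fin n → ℕ) j : ℕ) : ℝ)) = ∑ j, (θ + (f j:ℝ)) + 1 := by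
    simp [Pi.single_apply, Finset.sum_add_distrib, add_assoc]
  have hpos : 0 < ∑ j, (θ + (f j:ℝ)) :=
    Finset.sum_pos (fun j _ => by positivity) ⟨l, mem_univ l⟩
  rw [h1, Real.Gamma_add_one hpos.ne']
  have h2 : ∏ j, Real.Gamma (θ + (((f + Pi.single l 1 : Fin n → ℕ) j : ℕ) : ℝ))
      = (θ + f l) * ∏ j, Real.Gamma (θ + f j) := by
    rw [← Finset.mul_prod_erase univ _ (mem_univ l),
      ← Finset.mul_prod_erase univ (fun j => Real.Gamma (θ + f j)) (mem_univ l)]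
    have : θ + (((f + Pi.single l 1 : Fin n → ℕ) l : ℕ) : ℝ) = θ + f l + 1 := by simp; ring
    rw [this, Real.Gamma_add_one (by positivity), mul_assoc]
    congr 2
    refine Finset.prod_congr rfl fun j hj => ?_
    have := (Finset.mem_erase.1 hj).1
    simp [this]
  rw [h2]
  have := (Real.Gamma_pos_of_pos hpos).ne'
  have := hpos.ne'
  rw [mul_div_mul_comm]
  ring

/-- integration by parts for the Dirichlet functional -/
lemma EE_ibp {n : ℕ} (θ : ℝ) (hθ : 0 < θ) (j l : Fin n) (h : MvPolynomial (Fin n) ℝ) :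
    EE θ (MvPolynomial.X j * MvPolynomial.X l *
        (MvPolynomial.pderiv j h - MvPolynomial.pderiv l h)
      + θ • ((MvPolynomial.X l - MvPolynomial.X j) * h)) = 0 := by
  induction h using MvPolynomial.induction_on' with
  | add p q hp hq =>
    refine Eq.trans ?_ ((congrArg₂ (· + ·) hp hq).trans (add_zero 0))
    simp only [← map_add (EE θ)]
    congr 1
    simp only [map_add, mul_add, smul_add]
    ring
  | monomial m a =>
    have e : ∀ l, EE θ (MvPolynomial.X l * MvPolynomial.monomial m a)
        = a * (wt θ m * ((θ + m l) / ∑ j, (θ + m j))) := by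
      intro l
      rw [← wt_succ θ hθ m l]
      have : (MvPolynomial.X l * MvPolynomial.monomial m a : MvPolynomial (Fin n) ℝ)
          = a • MvPolynomial.monomial (m + Finsupp.single l 1) 1 := by
        rw [MvPolynomial.X, MvPolynomial.monomial_mul, MvPolynomial.smul_monomial, add_comm]; simp
      rw [this, map_smul, EE_monomial, smul_eq_mul]
      congr 2
      ext i
      simp [Finsupp.single_apply, Pi.single_apply, eq_comm]
    have e1 : (MvPolynomial.X j * MvPolynomial.X l *
        (MvPolynomial.pderiv j (MvPolynomial.monomial m a) - MvPolynomial.pderiv l (MvPolynomial.monomial m a))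
      + θ • ((MvPolynomial.X l - MvPolynomial.X j) * (MvPolynomial.monomial m a)) : MvPolynomial (Fin n) ℝ)
      = ((m j : ℝ) + θ) • (MvPolynomial.X l * MvPolynomial.monomial m a)
        - ((m l : ℝ) + θ) • (MvPolynomial.X j * MvPolynomial.monomial m a) := by
      have a1 := MvPolynomial.X_mul_pderiv_monomial (i := j) (m := m) (r := a)
      have a2 := MvPolynomial.X_mul_pderiv_monomial (i := l) (m := m) (r := a)
      rw [← Nat.cast_smul_eq_nsmul ℝ] at a1 a2
      simp only [MvPolynomial.smul_eq_C_mul, map_add] at a1 a2 ⊢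
      linear_combination MvPolynomial.X l * a1 - MvPolynomial.X j * a2
    rw [e1, map_sub, map_smul, map_smul, e, e, smul_eq_mul, smul_eq_mul]
    ring


noncomputable def MM {n : ℕ} {α : Type*} (z : α → ℝ) (a : α) : MvPolynomial (Fin n ⊕ Fin n) ℝ :=
  ∑ j, MvPolynomial.X (Sum.inl j) * LL Sum.inr (univ.erase j) (z a)

noncomputable def mm {n : ℕ} {α : Type*} (x : Fin n → ℝ) (z : α → ℝ) (a : α) :
    MvPolynomial (Fin n) ℝ :=
  ∑ j, MvPolynomial.C (PP x (univ.erase j) (z a)) * MvPolynomial.X j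

noncomputable def dd {n : ℕ} {α : Type*} (x : Fin n → ℝ) (z : α → ℝ) (i : Fin n) (a : α) :
    MvPolynomial (Fin n) ℝ :=
  ∑ j ∈ univ.erase i, MvPolynomial.C (PP x ((univ.erase j).erase i) (z a)) * MvPolynomial.X j

lemma evx_LL {n : ℕ} (x : Fin n → ℝ) (s : Finset (Fin n)) (t : ℝ) :
    evx x (LL Sum.inr s t) = MvPolynomial.C (PP x s t) := by
  simp [evx, LL, PP]

lemma evx_MM {n : ℕ} {α : Type*} (x : Fin n → ℝ) (z : α → ℝ) (a : α) :
    evx x (MM z a) = mm x z a := by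
  unfold MM mm
  rw [map_sum]
  refine Finset.sum_congr rfl fun j _ => ?_
  rw [map_mul, evx_LL, mul_comm]
  simp [evx]

lemma pderiv_MM {n : ℕ} {α : Type*} (z : α → ℝ) (i : Fin n) (a : α) :
    MvPolynomial.pderiv (Sum.inr i) (MM z a : MvPolynomial (Fin n ⊕ Fin n) ℝ)
      = - ∑ j ∈ univ.erase i, MvPolynomial.X (Sum.inl j)
          * LL Sum.inr ((univ.erase j).erase i) (z a) := by
  unfold MM
  rw [map_sum, ← Finset.add_sum_erase univ _ (mem_univ i), ← Finset.sum_neg_distrib]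
  have h : ∀ j : Fin n, MvPolynomial.pderiv (Sum.inr i)
      (MvPolynomial.X (Sum.inl j) * LL Sum.inr (univ.erase j) (z a) : MvPolynomial (Fin n ⊕ Fin n) ℝ)
      = MvPolynomial.X (Sum.inl j) * if i ∈ univ.erase j then
        - LL Sum.inr ((univ.erase j).erase i) (z a) else 0 := by
    intro j
    rw [Derivation.leibniz, MvPolynomial.pderiv_X_of_ne (by simp),
      LL_pderiv _ Sum.inr_injective]
    simp
  rw [h]
  simp only [mem_erase, ne_eq, not_true_eq_false, false_and, if_false, mul_zero, zero_add]
  refine Finset.sum_congr rfl fun j hj => ?_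
  rw [h, if_pos (by simp; exact (Finset.mem_erase.1 hj).1.symm), mul_neg]

lemma pderiv2_MM {n : ℕ} {α : Type*} (z : α → ℝ) (i : Fin n) (a : α) :
    MvPolynomial.pderiv (Sum.inr i) (MvPolynomial.pderiv (Sum.inr i)
      (MM z a : MvPolynomial (Fin n ⊕ Fin n) ℝ)) = 0 := by
  rw [pderiv_MM, map_neg, map_sum, neg_eq_zero]
  refine Finset.sum_eq_zero fun j _ => ?_
  rw [Derivation.leibniz, MvPolynomial.pderiv_X_of_ne (by simp),
      LL_pderiv _ Sum.inr_injective]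
  simp

lemma evx_pderiv_MM {n : ℕ} {α : Type*} (x : Fin n → ℝ) (z : α → ℝ) (i : Fin n) (a : α) :
    evx x (MvPolynomial.pderiv (Sum.inr i) (MM z a)) = - dd x z i a := by
  rw [pderiv_MM, map_neg, map_sum]
  unfold dd
  congr 1
  refine Finset.sum_congr rfl fun j _ => ?_
  rw [map_mul, evx_LL, mul_comm]
  simp [evx]

lemma evx_aeval {n : ℕ} {α : Type*} (x : Fin n → ℝ) (z : α → ℝ) (F : MvPolynomial α ℝ) :
    evx x (MvPolynomial.aeval (MM z) F) = MvPolynomial.aeval (mm x z) F := by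
  have : (evx x).comp (MvPolynomial.aeval (MM z)) = MvPolynomial.aeval (mm x z) := by
    apply MvPolynomial.algHom_ext
    intro a
    simp [evx_MM]
  exact DFunLike.congr_fun this F

/-- the candidate `Q`. -/
noncomputable def QQ {n : ℕ} {α : Type*} (θ : ℝ) (z : α → ℝ) (F : MvPolynomial α ℝ) :
    MvPolynomial (Fin n) ℝ := EX θ (MvPolynomial.aeval (MM z) F)

lemma QQ_symm {n : ℕ} {α : Type*} (θ : ℝ) (z : α → ℝ) (F : MvPolynomial α ℝ) :
    (QQ θ z F : MvPolynomial (Fin n) ℝ).IsSymmetric := by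
  intro σ
  unfold QQ
  rw [EX_rename]
  congr 1
  have : (MvPolynomial.rename (Equiv.sumCongr σ σ)).comp (MvPolynomial.aeval (R := ℝ) (MM (n := n) z))
      = MvPolynomial.aeval (MM z) := by
    apply MvPolynomial.algHom_ext
    intro a
    simp only [AlgHom.comp_apply, MvPolynomial.aeval_X]
    unfold MM
    rw [map_sum]
    refine Fintype.sum_equiv σ _ _ fun j => ?_
    rw [map_mul]
    congr 1
    · simp
    · unfold LL
      rw [map_prod]
      refine Finset.prod_bij (fun i _ => σ i) ?_ ?_ ?_ ?_
      · intro i hi; simpa using hi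
      · intro i _ j _ h; exact σ.injective h
      · intro i hi
        exact ⟨σ.symm i, by simp at hi ⊢; intro h; exact hi (by rw [← h]; simp), by simp⟩
      · intro i _; simp
  exact DFunLike.congr_fun this F

lemma QQ_eval {n : ℕ} {α : Type*} (θ : ℝ) (z : α → ℝ) (F : MvPolynomial α ℝ) (x : Fin n → ℝ) :
    MvPolynomial.eval x (QQ θ z F) = EE θ (MvPolynomial.aeval (mm x z) F) := by
  rw [QQ, EX_eval, evx_aeval]

lemma QQ_pd {n : ℕ} {α : Type*} [Fintype α] (θ : ℝ) (z : α → ℝ) (F : MvPolynomial α ℝ)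
    (x : Fin n → ℝ) (i : Fin n) :
    pd (fun v => MvPolynomial.eval v (QQ θ z F)) i x
      = - EE θ (∑ a, MvPolynomial.aeval (mm x z) (MvPolynomial.pderiv a F) * dd x z i a) := by
  rw [pd_eval, QQ, EX_pderiv, EX_eval, deriv_chain, map_sum, ← map_neg, ← Finset.sum_neg_distrib]
  congr 1
  refine Finset.sum_congr rfl fun a _ => ?_
  rw [map_mul, evx_aeval, evx_pderiv_MM, mul_neg]

lemma QQ_pd2 {n : ℕ} {α : Type*} [Fintype α] (θ : ℝ) (z : α → ℝ) (F : MvPolynomial α ℝ)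
    (x : Fin n → ℝ) (i : Fin n) :
    pd2 (fun v => MvPolynomial.eval v (QQ θ z F)) i x
      = EE θ (∑ a, ∑ b, MvPolynomial.aeval (mm x z) (MvPolynomial.pderiv b (MvPolynomial.pderiv a F))
          * (dd x z i a * dd x z i b)) := by
  rw [pd2_eval, QQ, EX_pderiv, EX_pderiv, EX_eval, deriv_chain2 _ _ (pderiv2_MM z i), map_sum]
  congr 1
  refine Finset.sum_congr rfl fun a _ => ?_
  rw [map_sum]
  refine Finset.sum_congr rfl fun b _ => ?_
  rw [map_mul, map_mul, evx_aeval, evx_pderiv_MM, evx_pderiv_MM, neg_mul_neg]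

/-- `P_j''(z)`. -/
noncomputable def P2 {n : ℕ} (x : Fin n → ℝ) (j : Fin n) (t : ℝ) : ℝ :=
  ∑ i ∈ univ.erase j, ∑ m ∈ (univ.erase j).erase i, PP x (((univ.erase j).erase i).erase m) t

noncomputable def h2 {n : ℕ} {α : Type*} [Fintype α] (θ : ℝ) (x : Fin n → ℝ) (z : α → ℝ)
    (F : MvPolynomial α ℝ) : MvPolynomial (Fin n) ℝ :=
  MvPolynomial.C (1 / 2) * ∑ a, ∑ b,
      MvPolynomial.aeval (mm x z) (MvPolynomial.pderiv b (MvPolynomial.pderiv a F)) *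
      (∑ i, dd x z i a * dd x z i b + ∑ j, ∑ l ∈ univ.erase j, MvPolynomial.X j * MvPolynomial.X l *
        MvPolynomial.C (PP x ((univ.erase j).erase l) (z a) * PP x ((univ.erase j).erase l) (z b)))
  - MvPolynomial.C (θ / 2) * ∑ a, MvPolynomial.aeval (mm x z) (MvPolynomial.pderiv a F) *
      ∑ j, MvPolynomial.X j * MvPolynomial.C (P2 x j (z a))
  + MvPolynomial.C (1 / 2) * ∑ a, MvPolynomial.aeval (mm x z) (MvPolynomial.pderiv a F) *
      ∑ i, MvPolynomial.C (x i) * dd x z i a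

lemma drift_scalar {n : ℕ} (x : Fin n → ℝ) (hx : Function.Injective x) (j : Fin n) (t : ℝ) :
    ∑ i ∈ univ.erase j, ∑ m ∈ univ.erase i, 1 / (x i - x m) * PP x ((univ.erase j).erase i) t
    = (1 / 2) * P2 x j t + ∑ i ∈ univ.erase j, 1 / (x i - x j) * PP x ((univ.erase j).erase i) t := by
  unfold P2
  rw [← sym_drift x hx, ← Finset.sum_add_distrib]
  refine Finset.sum_congr rfl fun i hi => ?_
  have hji : j ∈ univ.erase i := by simp; exact (Finset.mem_erase.1 hi).1.symm
  rw [← Finset.add_sum_erase (univ.erase i) _ hji, add_comm,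
    Finset.erase_right_comm (s := univ) (a := i)]

lemma drift_poly {n : ℕ} {α : Type*} (x : Fin n → ℝ) (hx : Function.Injective x) (z : α → ℝ)
    (a : α) :
    ∑ i, ∑ m ∈ univ.erase i, MvPolynomial.C (1 / (x i - x m)) * dd x z i a
      = MvPolynomial.C (1 / 2) * ∑ j, MvPolynomial.X j * MvPolynomial.C (P2 x j (z a))
      + ∑ j, ∑ i ∈ univ.erase j, MvPolynomial.X j *
          MvPolynomial.C (1 / (x i - x j) * PP x ((univ.erase j).erase i) (z a)) := by
  have h1 : ∑ i, ∑ m ∈ univ.erase i, MvPolynomial.C (1 / (x i - x m)) * dd x z i a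
      = ∑ j, MvPolynomial.X j * MvPolynomial.C (∑ i ∈ univ.erase j, ∑ m ∈ univ.erase i,
          1 / (x i - x m) * PP x ((univ.erase j).erase i) (z a)) := by
    simp only [map_sum, Finset.mul_sum]
    rw [sum_erase_swap (fun j i => ∑ m ∈ univ.erase i, MvPolynomial.X j * MvPolynomial.C (
          1 / (x i - x m) * PP x ((univ.erase j).erase i) (z a)))]
    refine Finset.sum_congr rfl fun i _ => ?_
    rw [Finset.sum_comm]
    refine Finset.sum_congr rfl fun m _ => ?_
    unfold dd
    rw [Finset.mul_sum]
    refine Finset.sum_congr rfl fun j _ => ?_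
    rw [map_mul]; ring
  rw [h1]
  simp_rw [drift_scalar x hx]
  rw [Finset.mul_sum, ← Finset.sum_add_distrib]
  refine Finset.sum_congr rfl fun j _ => ?_
  simp only [map_add, map_mul, map_sum, mul_add, Finset.mul_sum]
  ring

lemma ibp_used {n : ℕ} {α : Type*} [Fintype α] (θ : ℝ) (hθ : 0 < θ) (x : Fin n → ℝ)
    (hx : Function.Injective x) (z : α → ℝ) (F : MvPolynomial α ℝ) :
    EE θ (MvPolynomial.C (1 / 2) * ∑ a, ∑ b,
        MvPolynomial.aeval (mm x z) (MvPolynomial.pderiv b (MvPolynomial.pderiv a F)) *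
        (∑ j, ∑ l ∈ univ.erase j, MvPolynomial.X j * MvPolynomial.X l *
        MvPolynomial.C (PP x ((univ.erase j).erase l) (z a) * PP x ((univ.erase j).erase l) (z b)))
      + MvPolynomial.C θ * ∑ a, MvPolynomial.aeval (mm x z) (MvPolynomial.pderiv a F) *
        ∑ j, ∑ i ∈ univ.erase j, MvPolynomial.X j *
          MvPolynomial.C (1 / (x i - x j) * PP x ((univ.erase j).erase i) (z a))) = 0 := by
  have hpd : ∀ j b, MvPolynomial.pderiv j (mm x z b) = MvPolynomial.C (PP x (univ.erase j) (z b)) := by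
    intro j b
    unfold mm
    rw [map_sum, Finset.sum_eq_single j]
    · simp
    · intro i _ hi
      simp [MvPolynomial.pderiv_X_of_ne hi]
    · simp
  have key : ∀ a j l, l ∈ univ.erase j → EE θ (
      ∑ b, MvPolynomial.aeval (mm x z) (MvPolynomial.pderiv b (MvPolynomial.pderiv a F)) *
        (MvPolynomial.X j * MvPolynomial.X l *
        MvPolynomial.C (PP x ((univ.erase j).erase l) (z a) * PP x ((univ.erase j).erase l) (z b)))
      + MvPolynomial.C θ * (MvPolynomial.aeval (mm x z) (MvPolynomial.pderiv a F) *
        ((MvPolynomial.X j - MvPolynomial.X l) * MvPolynomial.C (1 / (x l - x j) * PP x ((univ.erase j).erase l) (z a))))) = 0 := by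
    intro a j l hl
    have hne : x j - x l ≠ 0 := sub_ne_zero.2 fun h => (Finset.mem_erase.1 hl).1 (hx h).symm
    have hne' : x l - x j ≠ 0 := sub_ne_zero.2 fun h => (Finset.mem_erase.1 hl).1 (hx h)
    have h0 := EE_ibp θ hθ j l (MvPolynomial.aeval (mm x z) (MvPolynomial.pderiv a F))
    have h1 := congrArg (fun r => (1 / (x j - x l) * PP x ((univ.erase j).erase l) (z a)) • r) h0
    simp only [← map_smul] at h1
    rw [smul_zero] at h1
    rw [← h1]
    congr 1
    rw [deriv_chain, deriv_chain, ← Finset.sum_sub_distrib]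
    simp only [hpd, MvPolynomial.smul_eq_C_mul]
    rw [mul_add, Finset.mul_sum, Finset.mul_sum]
    congr 1
    · refine Finset.sum_congr rfl fun b _ => ?_
      rw [← mul_sub, ← map_sub, PP_sub x univ (z b) (mem_univ j) (mem_univ l) (Finset.mem_erase.1 hl).1.symm]
      have : PP x ((univ.erase j).erase l) (z a) * PP x ((univ.erase j).erase l) (z b)
        = (1 / (x j - x l) * PP x ((univ.erase j).erase l) (z a)) *
          ((x j - x l) * PP x ((univ.erase j).erase l) (z b)) := by
        field_simp
      rw [this, map_mul]
      ring
    · have : 1 / (x l - x j) * PP x ((univ.erase j).erase l) (z a)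
        = - (1 / (x j - x l) * PP x ((univ.erase j).erase l) (z a)) := by
        rw [← neg_sub, div_neg]; ring
      rw [this, map_neg]
      ring
  have tot : EE θ (MvPolynomial.C (1 / 2) * ∑ a, ∑ j, ∑ l ∈ univ.erase j, (
      ∑ b, MvPolynomial.aeval (mm x z) (MvPolynomial.pderiv b (MvPolynomial.pderiv a F)) *
        (MvPolynomial.X j * MvPolynomial.X l *
        MvPolynomial.C (PP x ((univ.erase j).erase l) (z a) * PP x ((univ.erase j).erase l) (z b)))
      + MvPolynomial.C θ * (MvPolynomial.aeval (mm x z) (MvPolynomial.pderiv a F) *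
        ((MvPolynomial.X j - MvPolynomial.X l) * MvPolynomial.C (1 / (x l - x j) * PP x ((univ.erase j).erase l) (z a)))))) = 0 := by
    rw [← MvPolynomial.smul_eq_C_mul, map_smul, map_sum]
    simp only [map_sum (EE θ)]
    rw [Finset.sum_eq_zero, smul_zero]
    intro a _
    refine Finset.sum_eq_zero fun j _ => Finset.sum_eq_zero fun l hl => key a j l hl
  rw [← tot]
  congr 1
  simp only [Finset.sum_add_distrib, mul_add]
  congr 1
  · congr 1
    refine Finset.sum_congr rfl fun a _ => ?_
    simp only [Finset.mul_sum]
    rw [Finset.sum_comm]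
    refine Finset.sum_congr rfl fun j _ => ?_
    rw [Finset.sum_comm]
  · rw [Finset.mul_sum, Finset.mul_sum]
    refine Finset.sum_congr rfl fun a _ => ?_
    have hs : ∑ j, ∑ l ∈ univ.erase j, (MvPolynomial.X j - MvPolynomial.X l) *
          MvPolynomial.C (1 / (x l - x j) * PP x ((univ.erase j).erase l) (z a))
        = MvPolynomial.C 2 * ∑ j, ∑ i ∈ univ.erase j, MvPolynomial.X j *
          MvPolynomial.C (1 / (x i - x j) * PP x ((univ.erase j).erase i) (z a)) := by
      simp only [sub_mul, Finset.sum_sub_distrib]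
      rw [sum_erase_swap (fun j l => MvPolynomial.X l *
          MvPolynomial.C (1 / (x l - x j) * PP x ((univ.erase j).erase l) (z a)))]
      have : ∀ j l, (MvPolynomial.X j * MvPolynomial.C (1 / (x j - x l) * PP x ((univ.erase l).erase j) (z a)) : MvPolynomial (Fin n) ℝ)
        = - (MvPolynomial.X j * MvPolynomial.C (1 / (x l - x j) * PP x ((univ.erase j).erase l) (z a))) := by
        intro j l
        rw [Finset.erase_right_comm (s := univ) (a := l)]
        have : 1 / (x j - x l) = - (1 / (x l - x j)) := by
          rw [← neg_sub, div_neg]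
        rw [this, neg_mul, map_neg, mul_neg]
      simp only [this, Finset.sum_neg_distrib]
      have c2 : (MvPolynomial.C 2 : MvPolynomial (Fin n) ℝ) = 2 := map_ofNat _ 2
      rw [c2]; ring
    have hh : (MvPolynomial.C (1/2) * MvPolynomial.C 2 : MvPolynomial (Fin n) ℝ) = 1 := by
      rw [← map_mul]; norm_num
    simp only [← Finset.mul_sum]
    rw [hs]
    simp only [← Finset.mul_sum]
    linear_combination (-(MvPolynomial.C θ * (MvPolynomial.aeval (mm x z) (MvPolynomial.pderiv a F) * ∑ j, MvPolynomial.X j * ∑ i ∈ univ.erase j,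
          MvPolynomial.C (1 / (x i - x j) * PP x ((univ.erase j).erase i) (z a))))) * hh

theorem QQ_gen {n : ℕ} {α : Type*} [Fintype α] (θ : ℝ) (hθ : 0 < θ) (x : Fin n → ℝ)
    (hx : Function.Injective x) (z : α → ℝ) (F : MvPolynomial α ℝ) :
    genOU θ (fun v => MvPolynomial.eval v (QQ θ z F)) x = EE θ (h2 θ x z F) := by
  unfold genOU genA
  simp only [QQ_pd, QQ_pd2]
  have t1 : 1 / 2 * ∑ i, EE θ (∑ a, ∑ b,
        MvPolynomial.aeval (mm x z) (MvPolynomial.pderiv b (MvPolynomial.pderiv a F))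
          * (dd x z i a * dd x z i b))
      = EE θ (MvPolynomial.C (1 / 2) * ∑ a, ∑ b,
        MvPolynomial.aeval (mm x z) (MvPolynomial.pderiv b (MvPolynomial.pderiv a F))
          * ∑ i, dd x z i a * dd x z i b) := by
    rw [← map_sum, ← MvPolynomial.smul_eq_C_mul, map_smul, smul_eq_mul]
    congr 2
    rw [Finset.sum_comm]
    refine Finset.sum_congr rfl fun a _ => ?_
    rw [Finset.sum_comm]
    refine Finset.sum_congr rfl fun b _ => ?_
    rw [Finset.mul_sum]
  have t2 : θ * ∑ i, ∑ j ∈ univ.erase i, 1 / (x i - x j) *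
        -EE θ (∑ a, MvPolynomial.aeval (mm x z) (MvPolynomial.pderiv a F) * dd x z i a)
      = - EE θ (MvPolynomial.C θ * ∑ a, MvPolynomial.aeval (mm x z) (MvPolynomial.pderiv a F) *
          ∑ i, ∑ m ∈ univ.erase i, MvPolynomial.C (1 / (x i - x m)) * dd x z i a) := by
    rw [← MvPolynomial.smul_eq_C_mul, map_smul, smul_eq_mul, ← mul_neg, ← map_neg]
    have hm : ∀ (c : ℝ) (h : MvPolynomial (Fin n) ℝ), c * EE θ h = EE θ (c • h) :=
      fun c h => by rw [map_smul, smul_eq_mul]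
    congr 1
    simp only [← map_neg (EE θ), hm, ← map_sum (EE θ)]
    congr 1
    rw [← Finset.sum_neg_distrib]
    simp only [Finset.mul_sum, ← Finset.sum_neg_distrib, Finset.smul_sum]
    rw [Finset.sum_comm (s := univ) (t := univ)]
    refine Finset.sum_congr rfl fun i _ => ?_
    rw [Finset.sum_comm]
    refine Finset.sum_congr rfl fun m _ => ?_
    refine Finset.sum_congr rfl fun a _ => ?_
    rw [MvPolynomial.smul_eq_C_mul]
    ring
  have t3 : 1 / 2 * ∑ i, x i *
        -EE θ (∑ a, MvPolynomial.aeval (mm x z) (MvPolynomial.pderiv a F) * dd x z i a)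
      = - EE θ (MvPolynomial.C (1 / 2) * ∑ a, MvPolynomial.aeval (mm x z) (MvPolynomial.pderiv a F) *
          ∑ i, MvPolynomial.C (x i) * dd x z i a) := by
    rw [← MvPolynomial.smul_eq_C_mul, map_smul, smul_eq_mul, ← mul_neg, ← map_neg]
    simp only [← map_neg (EE θ), ← smul_eq_mul (a := x _), ← map_smul (EE θ), ← map_sum (EE θ)]
    congr 2
    simp only [Finset.smul_sum, Finset.mul_sum, ← Finset.sum_neg_distrib]
    rw [Finset.sum_comm]
    refine Finset.sum_congr rfl fun a _ => ?_
    refine Finset.sum_congr rfl fun i _ => ?_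
    rw [MvPolynomial.smul_eq_C_mul]
    ring
  rw [t1, t2, t3]
  refine Eq.trans (add_zero _).symm ?_
  rw [← ibp_used θ hθ x hx z F]
  simp only [← map_neg (EE θ), ← map_sub (EE θ), ← map_add (EE θ)]
  congr 1
  unfold h2
  simp only [drift_poly x hx, mul_add, Finset.sum_add_distrib]
  have e : ∑ a, MvPolynomial.aeval (mm x z) (MvPolynomial.pderiv a F) *
        (MvPolynomial.C (1 / 2) * ∑ j, MvPolynomial.X j * MvPolynomial.C (P2 x j (z a)))
      = MvPolynomial.C (1 / 2) * ∑ a, MvPolynomial.aeval (mm x z) (MvPolynomial.pderiv a F) *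
        ∑ j, MvPolynomial.X j * MvPolynomial.C (P2 x j (z a)) := by
    rw [Finset.mul_sum]
    exact Finset.sum_congr rfl fun a _ => by ring
  have e' : (MvPolynomial.C (θ / 2) : MvPolynomial (Fin n) ℝ)
      = MvPolynomial.C θ * MvPolynomial.C (1 / 2) := by
    rw [← map_mul]; congr 1; ring
  rw [e, e']
  ring

lemma genA_aux {k : ℕ} {α : Type*} [Fintype α] (z : α → ℝ) (F : MvPolynomial α ℝ) (y : Fin k → ℝ)
    (G : MvPolynomial α ℝ) :
    MvPolynomial.eval y (MvPolynomial.aeval (fun a => LL (id : Fin k → Fin k) univ (z a)) G)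
      = MvPolynomial.eval (fun a => PP y univ (z a)) G := by
  have : (MvPolynomial.aeval (R := ℝ) y).comp (MvPolynomial.aeval (fun a => LL (id : Fin k → Fin k) univ (z a)))
      = MvPolynomial.aeval (fun a => PP y univ (z a)) := by
    apply MvPolynomial.algHom_ext
    intro a
    simp only [AlgHom.comp_apply, MvPolynomial.aeval_X]
    rw [MvPolynomial.aeval_eq_eval]
    exact LL_eval _ _ _ _
  have h := DFunLike.congr_fun this G
  simpa [MvPolynomial.aeval_eq_eval] using h

lemma eval_mm {k : ℕ} {α : Type*} (x : Fin (k + 1) → ℝ) (hx : Function.Injective x)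
    (y : Fin k → ℝ) (z : α → ℝ) (G : MvPolynomial α ℝ) :
    MvPolynomial.eval (DAw x y) (MvPolynomial.aeval (mm x z) G)
      = MvPolynomial.eval (fun a => PP y univ (z a)) G := by
  have : (MvPolynomial.aeval (R := ℝ) (DAw x y)).comp (MvPolynomial.aeval (mm x z))
      = MvPolynomial.aeval (fun a => PP y univ (z a)) := by
    apply MvPolynomial.algHom_ext
    intro a
    simp only [AlgHom.comp_apply, MvPolynomial.aeval_X]
    rw [MvPolynomial.aeval_eq_eval, DAw_id0 x hx y]
    simp [mm, mul_comm]
  have h := DFunLike.congr_fun this G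
  simpa [MvPolynomial.aeval_eq_eval] using h

lemma eval_dd {n : ℕ} {α : Type*} (x : Fin n → ℝ) (w : Fin n → ℝ) (z : α → ℝ) (i : Fin n) (a : α) :
    MvPolynomial.eval w (dd x z i a) = DD x w i (z a) := by
  simp [dd, DD, mul_comm]

theorem P_gen {k : ℕ} {α : Type*} [Fintype α] (θ : ℝ) (x : Fin (k + 1) → ℝ)
    (hx : Function.Injective x) (y : Fin k → ℝ) (hy : Function.Injective y)
    (z : α → ℝ) (F : MvPolynomial α ℝ) :
    genOU θ (fun v => MvPolynomial.eval v
        (MvPolynomial.aeval (fun a => LL (id : Fin k → Fin k) univ (z a)) F)) y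
      = MvPolynomial.eval (DAw x y) (h2 θ x z F) := by
  have hL : ∀ i a, MvPolynomial.pderiv i (LL (id : Fin k → Fin k) univ (z a))
      = - LL id (univ.erase i) (z a) := by
    intro i a
    have := LL_pderiv (id : Fin k → Fin k) Function.injective_id univ (z a) i
    simpa using this
  have hL2 : ∀ i a, MvPolynomial.pderiv i (MvPolynomial.pderiv i (LL (id : Fin k → Fin k) univ (z a)))
      = 0 := by
    intro i a
    exact LL_pderiv2 (id : Fin k → Fin k) Function.injective_id univ (z a) i
  have hE : ∀ s a, MvPolynomial.eval y (LL (id : Fin k → Fin k) s (z a)) = PP y s (z a) := by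
    intro s a; exact LL_eval _ _ _ _
  set f1 : α → ℝ := fun a => MvPolynomial.eval (fun a => PP y univ (z a)) (MvPolynomial.pderiv a F) with hf1
  set f2 : α → α → ℝ := fun a b => MvPolynomial.eval (fun a => PP y univ (z a))
    (MvPolynomial.pderiv b (MvPolynomial.pderiv a F)) with hf2
  have d1 : ∀ i, pd (fun v => MvPolynomial.eval v
        (MvPolynomial.aeval (fun a => LL (id : Fin k → Fin k) univ (z a)) F)) i y
      = - ∑ a, f1 a * PP y (univ.erase i) (z a) := by
    intro i
    rw [pd_eval, deriv_chain, map_sum, ← Finset.sum_neg_distrib]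
    refine Finset.sum_congr rfl fun a _ => ?_
    rw [map_mul, genA_aux z F, hL, map_neg, hE, mul_neg]
  have d2 : ∀ i, pd2 (fun v => MvPolynomial.eval v
        (MvPolynomial.aeval (fun a => LL (id : Fin k → Fin k) univ (z a)) F)) i y
      = ∑ a, ∑ b, f2 a b * (PP y (univ.erase i) (z a) * PP y (univ.erase i) (z b)) := by
    intro i
    rw [pd2_eval, deriv_chain2 _ _ (hL2 i), map_sum]
    refine Finset.sum_congr rfl fun a _ => ?_
    rw [map_sum]
    refine Finset.sum_congr rfl fun b _ => ?_
    rw [map_mul, map_mul, genA_aux z F, hL, hL, map_neg, map_neg, hE, hE, neg_mul_neg]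
  have r : MvPolynomial.eval (DAw x y) (h2 θ x z F)
      = 1 / 2 * ∑ a, ∑ b, f2 a b * (∑ i, PP y (univ.erase i) (z a) * PP y (univ.erase i) (z b))
        - θ * ∑ a, f1 a * ∑ i, ∑ m ∈ univ.erase i, 1 / (y i - y m) * PP y (univ.erase i) (z a)
        + 1 / 2 * ∑ a, f1 a * ∑ i, y i * PP y (univ.erase i) (z a) := by
    unfold h2
    simp only [map_add, map_sub, map_mul, map_sum, MvPolynomial.eval_C, MvPolynomial.eval_X,
      eval_mm x hx, eval_dd, sym_drift y hy, DAw_id2 x hx y, euler_id x hx y, gamma_id x hx y]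
    congr 2
    simp only [P2, Finset.mul_sum]
    refine Finset.sum_congr rfl fun a _ => ?_
    refine Finset.sum_congr rfl fun j _ => ?_
    refine Finset.sum_congr rfl fun i _ => ?_
    refine Finset.sum_congr rfl fun l _ => ?_
    ring
  rw [r]
  unfold genOU genA
  simp only [d1, d2]
  have s1 : ∑ i, ∑ a, ∑ b, f2 a b * (PP y (univ.erase i) (z a) * PP y (univ.erase i) (z b))
      = ∑ a, ∑ b, f2 a b * (∑ i, PP y (univ.erase i) (z a) * PP y (univ.erase i) (z b)) := by
    rw [Finset.sum_comm]
    refine Finset.sum_congr rfl fun a _ => ?_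
    rw [Finset.sum_comm]
    refine Finset.sum_congr rfl fun b _ => ?_
    rw [Finset.mul_sum]
  have s2 : ∑ i, ∑ j ∈ univ.erase i, 1 / (y i - y j) * -∑ a, f1 a * PP y (univ.erase i) (z a)
      = - ∑ a, f1 a * ∑ i, ∑ m ∈ univ.erase i, 1 / (y i - y m) * PP y (univ.erase i) (z a) := by
    simp only [Finset.mul_sum, ← Finset.sum_neg_distrib]
    rw [Finset.sum_comm (s := (univ : Finset α))]
    refine Finset.sum_congr rfl fun i _ => ?_
    rw [Finset.sum_comm]
    refine Finset.sum_congr rfl fun a _ => ?_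
    refine Finset.sum_congr rfl fun m _ => ?_
    ring
  have s3 : ∑ i, y i * -∑ a, f1 a * PP y (univ.erase i) (z a)
      = - ∑ a, f1 a * ∑ i, y i * PP y (univ.erase i) (z a) := by
    simp only [Finset.mul_sum, ← Finset.sum_neg_distrib]
    rw [Finset.sum_comm (s := (univ : Finset α))]
    refine Finset.sum_congr rfl fun i _ => ?_
    refine Finset.sum_congr rfl fun a _ => ?_
    ring
  rw [s1, s2, s3]
  ring


noncomputable def VV {n : ℕ} (x : Fin n → ℝ) : ℝ := ∏ i, ∏ j ∈ Ioi i, (x j - x i)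

lemma VV_pos {n : ℕ} (x : Fin n → ℝ) (hx : StrictMono x) : 0 < VV x :=
  Finset.prod_pos fun i _ => Finset.prod_pos fun j hj => sub_pos.2 (hx (Finset.mem_Ioi.1 hj))

lemma VV_sq {n : ℕ} (x : Fin n → ℝ) (hx : StrictMono x) :
    ∏ j, |PP x (univ.erase j) (x j)| = VV x ^ 2 := by
  have h : ∀ j, |PP x (univ.erase j) (x j)|
      = (∏ l ∈ Iio j, (x j - x l)) * ∏ l ∈ Ioi j, (x l - x j) := by
    intro j
    have e : univ.erase j = Iio j ∪ Ioi j := by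
      ext l; simp [lt_or_lt_iff_ne]
    have d : Disjoint (Iio j) (Ioi j) := by
      rw [Finset.disjoint_left]; intro a; simp only [mem_Iio, mem_Ioi]; exact fun h h' => lt_asymm h h'
    unfold PP
    rw [e, Finset.prod_union d, abs_mul, Finset.abs_prod, Finset.abs_prod]
    congr 1
    · refine Finset.prod_congr rfl fun l hl => abs_of_pos (sub_pos.2 (hx (Finset.mem_Iio.1 hl)))
    · refine Finset.prod_congr rfl fun l hl => ?_
      rw [abs_sub_comm]
      exact abs_of_pos (sub_pos.2 (hx (Finset.mem_Ioi.1 hl)))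
  simp only [h, Finset.prod_mul_distrib, sq]
  congr 1
  unfold VV
  rw [Finset.prod_comm' (s' := fun l => Ioi l) (t' := univ) (by simp)]

def WO {k : ℕ} (x : Fin (k + 1) → ℝ) : Set (Fin k → ℝ) :=
  Set.univ.pi fun i => Set.Ioo (x i.castSucc) (x i.succ)

lemma WO_strictMono {k : ℕ} {x : Fin (k + 1) → ℝ} (hx : StrictMono x) {y : Fin k → ℝ}
    (hy : y ∈ WO x) : StrictMono y := by
  intro i j hij
  have h1 := (hy i trivial).2
  have h2 := (hy j trivial).1
  have : x i.succ ≤ x j.castSucc := hx.monotone (by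
    rw [Fin.le_def]; simp; exact hij)
  linarith

lemma PP_erase_succAbove {k : ℕ} (x : Fin (k + 1) → ℝ) (j : Fin (k + 1)) (t : ℝ) :
    PP x (univ.erase j) t = ∏ i, (t - x (j.succAbove i)) := by
  unfold PP
  have : univ.erase j = univ.image j.succAbove := by
    rw [Fin.image_succAbove_univ]; ext; simp
  rw [this, Finset.prod_image (fun a _ b _ h => Fin.succAbove_right_injective h)]

lemma DAw_pos {k : ℕ} {x : Fin (k + 1) → ℝ} (hx : StrictMono x) {y : Fin k → ℝ}
    (hy : y ∈ WO x) (j : Fin (k + 1)) : 0 < DAw x y j := by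
  unfold DAw
  rw [PP_erase_succAbove]
  unfold PP
  rw [← Finset.prod_div_distrib]
  refine Finset.prod_pos fun i _ => ?_
  have h := hy i trivial
  rcases lt_or_ge i.castSucc j with hj | hj
  · rw [Fin.succAbove_of_castSucc_lt _ _ hj]
    have h1 : x i.succ ≤ x j := hx.monotone (by rw [Fin.lt_def] at hj; rw [Fin.le_def]; simp at *; omega)
    exact div_pos (by linarith [h.2]) (by linarith [h.1, h.2])
  · rw [Fin.succAbove_of_le_castSucc _ _ hj]
    have h1 : x j ≤ x i.castSucc := hx.monotone hj
    exact div_pos_of_neg_of_neg (by linarith [h.1]) (by linarith [h.1, h.2])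

lemma PP_sign {k : ℕ} {x : Fin (k + 1) → ℝ} (hx : StrictMono x) (i : Fin k) :
    PP x (univ.erase i.castSucc) (x i.castSucc) * PP x (univ.erase i.succ) (x i.succ) < 0 := by
  have hne : i.castSucc ≠ i.succ := (Fin.castSucc_lt_succ).ne
  rw [PP_erase x (univ.erase i.castSucc) _ (i := i.succ) (by simp [hne.symm]),
    PP_erase x (univ.erase i.succ) _ (i := i.castSucc) (by simp [hne]),
    Finset.erase_right_comm (s := univ) (a := i.succ)]
  have hlt : x i.castSucc < x i.succ := hx Fin.castSucc_lt_succ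
  have hp : 0 < PP x ((univ.erase i.castSucc).erase i.succ) (x i.castSucc)
      * PP x ((univ.erase i.castSucc).erase i.succ) (x i.succ) := by
    unfold PP
    rw [← Finset.prod_mul_distrib]
    refine Finset.prod_pos fun l hl => ?_
    simp only [mem_erase, mem_univ, and_true] at hl
    rcases lt_or_gt_of_ne hl.2 with h | h
    · have h1 := hx h
      exact mul_pos (by linarith) (by linarith)
    · have h2 : i.succ < l := lt_of_le_of_ne (by
        rw [Fin.lt_def] at h; rw [Fin.le_def]; simp at *; omega) hl.1.symm
      have h1 := hx h2
      exact mul_pos_of_neg_of_neg (by linarith) (by linarith)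
  have : 0 < (x i.succ - x i.castSucc) * (x i.succ - x i.castSucc) :=
    mul_pos (by linarith) (by linarith)
  nlinarith [mul_pos this hp]

lemma root_exists {a b : ℝ} (hab : a < b) (p : Polynomial ℝ) (h : p.eval a * p.eval b < 0) :
    ∃ c ∈ Set.Ioo a b, p.eval c = 0 := by
  rcases mul_neg_iff.1 h with ⟨h1, h2⟩ | ⟨h1, h2⟩
  · exact intermediate_value_Ioo' hab.le p.continuous.continuousOn ⟨h2, h1⟩
  · exact intermediate_value_Ioo hab.le p.continuous.continuousOn ⟨h1, h2⟩

noncomputable def ff {k : ℕ} (x : Fin (k + 1) → ℝ) (v : Fin (k + 1) → ℝ) (j : Fin (k + 1)) : ℝ :=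
  v 0 * DAw x (Fin.tail v) j

def SS {k : ℕ} (x : Fin (k + 1) → ℝ) : Set (Fin (k + 1) → ℝ) :=
  {v | 0 < v 0 ∧ Fin.tail v ∈ WO x}

lemma DAw_inj {k : ℕ} {x : Fin (k + 1) → ℝ} (hx : StrictMono x) {y y' : Fin k → ℝ}
    (hy : y ∈ WO x) (hy' : y' ∈ WO x) (h : ∀ j, DAw x y j = DAw x y' j) : y = y' := by
  have hp : ∀ y : Fin k → ℝ, PX y univ = ∑ j, Polynomial.C (DAw x y j) * PX x (univ.erase j) := by
    intro y
    refine interp x hx.injective _ (by rw [PX_natDegree]; simp) _ fun j => ?_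
    rw [PX_eval, DAw, div_mul_cancel₀ _ (PP_self_ne x hx.injective j)]
  have he : PX y univ = PX y' univ := by
    rw [hp y, hp y']; simp only [h]
  funext i
  have h0 : PP y' univ (y i) = 0 := by
    rw [← PX_eval, ← he, PX_eval]; exact PP_zero_of_mem y univ i (mem_univ _)
  unfold PP at h0
  obtain ⟨l, _, hl⟩ := Finset.prod_eq_zero_iff.1 h0
  have hl' : y i = y' l := by linarith
  have hil : i = l := by
    by_contra hne
    rcases lt_or_gt_of_ne hne with hlt | hlt
    · have h1 := (hy i trivial).2
      have h2 := (hy' l trivial).1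
      have : x i.succ ≤ x l.castSucc := hx.monotone (by rw [Fin.le_def]; simp; exact hlt)
      linarith
    · have h1 := (hy i trivial).1
      have h2 := (hy' l trivial).2
      have : x l.succ ≤ x i.castSucc := hx.monotone (by rw [Fin.le_def]; simp; exact hlt)
      linarith
  rw [hl', hil]

lemma DAw_surj {k : ℕ} {x : Fin (k + 1) → ℝ} (hx : StrictMono x) {u : Fin (k + 1) → ℝ}
    (hu : ∀ j, 0 < u j) : ∃ y ∈ WO x, ∀ j, (∑ l, u l) * DAw x y j = u j := by
  set p : Polynomial ℝ := ∑ j, Polynomial.C (u j) * PX x (univ.erase j) with hp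
  have hev : ∀ j, p.eval (x j) = u j * PP x (univ.erase j) (x j) := by
    intro j
    rw [hp, Polynomial.eval_finsetSum, Finset.sum_eq_single j]
    · simp [PX_eval]
    · intro b _ hb
      simp [PX_eval]
      right
      exact PP_zero_of_mem x _ j (by simp [hb.symm])
    · simp
  have hroot : ∀ i : Fin k, ∃ c ∈ Set.Ioo (x i.castSucc) (x i.succ), p.eval c = 0 := by
    intro i
    refine root_exists (hx Fin.castSucc_lt_succ) p ?_
    rw [hev, hev]
    have := PP_sign hx i
    have h2 := mul_pos (hu i.castSucc) (hu i.succ)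
    nlinarith [mul_neg_of_pos_of_neg h2 this]
  choose y hy hy0 using hroot
  have hyW : y ∈ WO x := fun i _ => hy i
  refine ⟨y, hyW, fun j => ?_⟩
  have hpk : p = Polynomial.C (∑ l, u l) * PX y univ := by
    refine Polynomial.eq_of_degree_sub_lt_of_eval_index_eq (s := (univ : Finset (Fin k))) (v := y)
      (WO_strictMono hx hyW).injective.injOn ?_ ?_
    · rw [Finset.card_univ, Fintype.card_fin]
      rw [Polynomial.degree_lt_iff_coeff_zero]
      intro m hm
      rw [hp]
      simp only [Polynomial.coeff_sub, Polynomial.finset_sum_coeff, Polynomial.coeff_C_mul]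
      rcases hm.eq_or_lt with rfl | hm
      · have h1 : ∀ j, (PX x (univ.erase j)).coeff k = 1 := by
          intro j
          have := (PX_monic x (univ.erase j)).coeff_natDegree
          rw [PX_natDegree] at this
          simpa using this
        have h2 : (PX y univ).coeff k = 1 := by
          have := (PX_monic y univ).coeff_natDegree
          rw [PX_natDegree] at this
          simpa using this
        simp [h1, h2]
      · have h1 : ∀ j, (PX x (univ.erase j)).coeff m = 0 := by
          intro j
          refine Polynomial.coeff_eq_zero_of_natDegree_lt ?_
          rw [PX_natDegree]; simpa using hm
        have h2 : (PX y univ).coeff m = 0 := by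
          refine Polynomial.coeff_eq_zero_of_natDegree_lt ?_
          rw [PX_natDegree]; simpa using hm
        simp [h1, h2]
    · intro i _
      rw [hy0, Polynomial.eval_mul, PX_eval, PP_zero_of_mem y univ i (mem_univ _), mul_zero]
  have h3 := hev j
  rw [hpk, Polynomial.eval_mul, PX_eval, Polynomial.eval_C] at h3
  rw [DAw, ← mul_div_assoc, h3, mul_div_cancel_right₀ _ (PP_self_ne x hx.injective j)]

lemma DAw_sum {k : ℕ} {x : Fin (k + 1) → ℝ} (hx : Function.Injective x) (y : Fin k → ℝ) :
    ∑ j, DAw x y j = 1 := by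
  have hp : PX y univ = ∑ j, Polynomial.C (DAw x y j) * PX x (univ.erase j) := by
    refine interp x hx _ (by rw [PX_natDegree]; simp) _ fun j => ?_
    rw [PX_eval, DAw, div_mul_cancel₀ _ (PP_self_ne x hx j)]
  have h1 : ∀ j, (PX x (univ.erase j)).coeff k = 1 := by
    intro j
    have := (PX_monic x (univ.erase j)).coeff_natDegree
    rw [PX_natDegree] at this
    simpa using this
  have h2 : (PX y univ).coeff k = 1 := by
    have := (PX_monic y univ).coeff_natDegree
    rw [PX_natDegree] at this
    simpa using this
  rw [hp] at h2
  simpa [Polynomial.finset_sum_coeff, h1] using h2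

lemma ff_injOn {k : ℕ} {x : Fin (k + 1) → ℝ} (hx : StrictMono x) : Set.InjOn (ff x) (SS x) := by
  intro v hv v' hv' h
  have h0 : v 0 = v' 0 := by
    have := congrArg (fun g : Fin (k + 1) → ℝ => ∑ j, g j) h
    simpa [ff, ← Finset.mul_sum, DAw_sum hx.injective] using this
  have ht : Fin.tail v = Fin.tail v' := by
    refine DAw_inj hx hv.2 hv'.2 fun j => ?_
    have := congrFun h j
    simp only [ff] at this
    rw [← h0] at this
    exact mul_left_cancel₀ hv.1.ne' this
  rw [← Fin.cons_self_tail v, ← Fin.cons_self_tail v', h0, ht]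

lemma ff_image {k : ℕ} {x : Fin (k + 1) → ℝ} (hx : StrictMono x) :
    ff x '' SS x = Set.univ.pi fun _ => Set.Ioi 0 := by
  ext u
  constructor
  · rintro ⟨v, hv, rfl⟩ j _
    exact mul_pos hv.1 (DAw_pos hx hv.2 j)
  · intro hu
    obtain ⟨y, hy, h⟩ := DAw_surj hx (u := u) fun j => hu j trivial
    refine ⟨Fin.cons (∑ l, u l) y, ⟨?_, ?_⟩, ?_⟩
    · simp only [Fin.cons_zero]
      exact Finset.sum_pos (fun l _ => hu l trivial) univ_nonempty
    · simpa using hy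
    · funext j
      simp [ff, h]


/-- polynomials entering the Jacobian -/
noncomputable def pj {k : ℕ} (y : Fin k → ℝ) : Fin (k + 1) → Polynomial ℝ :=
  Fin.cons (PX y univ) (fun i => PX y (univ.erase i))

lemma pj_natDegree {k : ℕ} (y : Fin k → ℝ) (l : Fin (k + 1)) : (pj y l).natDegree < k + 1 := by
  refine Fin.cases ?_ (fun i => ?_) l
  · simp [pj, PX_natDegree]
  · simp [pj, PX_natDegree]

lemma vand_mul {k : ℕ} (w : Fin (k + 1) → ℝ) (y : Fin k → ℝ) :
    Matrix.vandermonde w * Matrix.of (fun m l : Fin (k + 1) => (pj y l).coeff m)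
      = Matrix.of fun m l => (pj y l).eval (w m) := by
  ext m l
  rw [Matrix.mul_apply, Matrix.of_apply, Polynomial.eval_eq_sum_range' (pj_natDegree y l),
    ← Fin.sum_univ_eq_sum_range (fun i => (pj y l).coeff i * w m ^ i)]
  refine Finset.sum_congr rfl fun i _ => ?_
  simp [Matrix.vandermonde_apply, mul_comm]

lemma detC {k : ℕ} (y : Fin k → ℝ) (hy : StrictMono y) :
    |(Matrix.of (fun m l : Fin (k + 1) => (pj y l).coeff m)).det| = VV y := by
  obtain ⟨t, ht⟩ : ∃ t : ℝ, ∀ i, t < y i := by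
    obtain ⟨t, ht⟩ := (Set.finite_range y).bddBelow
    exact ⟨t - 1, fun i => by have := ht (Set.mem_range_self i); linarith⟩
  have h := congrArg Matrix.det (vand_mul (Fin.cons t y) y)
  rw [Matrix.det_mul, Matrix.det_vandermonde] at h
  have hv : (∏ i : Fin (k + 1), ∏ j ∈ Ioi i, ((Fin.cons t y : Fin (k + 1) → ℝ) j - (Fin.cons t y : Fin (k + 1) → ℝ) i))
      = (∏ i, (y i - t)) * VV y := by
    rw [Fin.prod_univ_succ, Fin.Ioi_zero_eq_map, Finset.prod_map]
    simp [VV, Fin.prod_Ioi_succ]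
  have hr : (Matrix.of fun m l => (pj y l).eval ((Fin.cons t y : Fin (k + 1) → ℝ) m)).det
      = PP y univ t * ∏ i, PP y (univ.erase i) (y i) := by
    rw [Matrix.det_of_isUpperTriangular]
    · rw [Fin.prod_univ_succ]
      simp [pj, PX_eval]
    · intro m l hml
      simp only [id] at hml
      obtain ⟨m, rfl⟩ : ∃ m' : Fin k, m = m'.succ := Fin.exists_succ_eq.2 (by
        rintro rfl; exact absurd hml (Fin.not_lt_zero _)) |>.imp fun _ h => h.symm
      revert hml
      refine Fin.cases ?_ (fun i => ?_) l
      · intro _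
        simp [pj, PX_eval, PP_zero_of_mem]
      · intro h
        have : m ≠ i := by rintro rfl; exact lt_irrefl _ h
        simp [pj, PX_eval, PP_zero_of_mem, this]
  rw [hv, hr] at h
  have h' := congrArg abs h
  rw [abs_mul, abs_mul, abs_mul, abs_of_pos (VV_pos y hy), Finset.abs_prod univ (fun i => PP y (univ.erase i) (y i)), VV_sq y hy] at h'
  have e : |∏ i, (y i - t)| = |PP y univ t| := by
    unfold PP
    rw [Finset.abs_prod, Finset.abs_prod]
    exact Finset.prod_congr rfl fun i _ => abs_sub_comm _ _
  have ne : |PP y univ t| ≠ 0 := by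
    rw [← e]
    refine abs_ne_zero.2 (Finset.prod_ne_zero_iff.2 fun i _ => (sub_pos.2 (ht i)).ne')
  rw [e, mul_assoc] at h'
  have h2 := mul_left_cancel₀ ne h'
  rw [sq] at h2
  exact mul_left_cancel₀ (VV_pos y hy).ne' h2

noncomputable def JM {k : ℕ} (x v : Fin (k + 1) → ℝ) : Matrix (Fin (k + 1)) (Fin (k + 1)) ℝ :=
  Matrix.of fun j l => (PP x (univ.erase j) (x j))⁻¹ *
    (Fin.cons 1 (fun _ => - v 0) : Fin (k + 1) → ℝ) l * (pj (Fin.tail v) l).eval (x j)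

lemma JM_det {k : ℕ} {x v : Fin (k + 1) → ℝ} (hx : StrictMono x) (hv : v ∈ SS x) :
    |(JM x v).det| = v 0 ^ k * (VV (Fin.tail v) / VV x) := by
  have h1 : JM x v = Matrix.of fun j l => (PP x (univ.erase j) (x j))⁻¹ *
      (Matrix.of fun j l => (Fin.cons 1 (fun _ => - v 0) : Fin (k + 1) → ℝ) l *
        (Matrix.of fun j l => (pj (Fin.tail v) l).eval (x j)) j l) j l := by
    ext j l; simp [JM, mul_assoc]
  rw [h1, Matrix.det_mul_column, Matrix.det_mul_row, ← vand_mul, Matrix.det_mul,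
    Matrix.det_vandermonde, abs_mul, abs_mul, abs_mul, detC _ (WO_strictMono hx hv.2),
    Finset.abs_prod]
  simp only [abs_inv]
  rw [Finset.prod_inv_distrib, VV_sq x hx]
  have : |∏ i : Fin (k + 1), ∏ j ∈ Ioi i, (x j - x i)| = VV x := abs_of_pos (VV_pos x hx)
  rw [this, Fin.prod_univ_succ]
  have hp := VV_pos x hx
  simp only [Fin.cons_zero, Fin.cons_succ, Finset.prod_const, one_mul, card_univ, Fintype.card_fin,
    abs_pow, abs_neg, abs_of_pos hv.1]
  field_simp

lemma ff_hasFDerivAt {k : ℕ} (x v : Fin (k + 1) → ℝ) :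
    HasFDerivAt (ff x) (Matrix.toLin' (JM x v)).toContinuousLinearMap v := by
  rw [hasFDerivAt_pi']
  intro j
  have hprod : HasFDerivAt (fun v : Fin (k + 1) → ℝ => ∏ i : Fin k, (x j - v i.succ))
      (∑ i : Fin k, (∏ l ∈ univ.erase i, (x j - v l.succ)) •
        (-(ContinuousLinearMap.proj (R := ℝ) (φ := fun _ : Fin (k + 1) => ℝ) i.succ))) v := by
    refine HasFDerivAt.finsetProd (u := univ) (g := fun (i : Fin k) (v : Fin (k + 1) → ℝ) => x j - v i.succ) fun i _ => ?_
    exact (ContinuousLinearMap.proj (R := ℝ) (φ := fun _ : Fin (k + 1) => ℝ) i.succ).hasFDerivAt.const_sub (x j)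
  have h0 := (ContinuousLinearMap.proj (R := ℝ) (φ := fun _ : Fin (k + 1) => ℝ) 0).hasFDerivAt (x := v)
  have h := (h0.mul hprod).mul_const ((PP x (univ.erase j) (x j))⁻¹)
  have e : (fun v => ff x v j) = fun v : Fin (k + 1) → ℝ =>
      (v 0 * ∏ i : Fin k, (x j - v i.succ)) * (PP x (univ.erase j) (x j))⁻¹ := by
    funext v
    simp only [ff, DAw, PP, Fin.tail]
    rw [div_eq_mul_inv, mul_assoc]
  rw [e]
  refine h.congr_fderiv ?_
  ext w
  simp [JM, Matrix.toLin'_apply, Matrix.mulVec, dotProduct, Fin.sum_univ_succ, pj, PX_eval, PP, Fin.tail, Finset.mul_sum]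
  rw [add_comm]
  simp only [mul_assoc]


lemma WO_meas {k : ℕ} (x : Fin (k + 1) → ℝ) : MeasurableSet (WO x) :=
  MeasurableSet.univ_pi fun _ => measurableSet_Ioo

lemma SS_eq {k : ℕ} (x : Fin (k + 1) → ℝ) :
    SS x = (MeasurableEquiv.piFinSuccAbove (fun _ : Fin (k + 1) => ℝ) 0) ⁻¹' (Set.Ioi 0 ×ˢ WO x) := by
  ext v
  simp only [SS, Set.mem_setOf_eq, Set.mem_preimage, Set.mem_prod, Set.mem_Ioi]
  rfl

lemma SS_meas {k : ℕ} (x : Fin (k + 1) → ℝ) : MeasurableSet (SS x) := by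
  rw [SS_eq]
  exact (MeasurableEquiv.measurable _) (measurableSet_Ioi.prod (WO_meas x))

lemma SS_integral {k : ℕ} (x : Fin (k + 1) → ℝ) (f : ℝ → ℝ) (g : (Fin k → ℝ) → ℝ) :
    ∫ v in SS x, f (v 0) * g (Fin.tail v) = (∫ t in Set.Ioi 0, f t) * ∫ y in WO x, g y := by
  rw [← setIntegral_prod_mul f g, SS_eq]
  have := (volume_preserving_piFinSuccAbove (fun _ : Fin (k + 1) => ℝ) 0).setIntegral_preimage_emb
    (MeasurableEquiv.measurableEmbedding _) (fun z : ℝ × (Fin k → ℝ) => f z.1 * g z.2) (Set.Ioi 0 ×ˢ WO x)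
  exact this

lemma Gamma_prod {n : ℕ} (a : Fin n → ℝ) (ha : ∀ j, 0 < a j) :
    ∫ u in (Set.univ.pi fun _ : Fin n => Set.Ioi (0:ℝ)), ∏ j, (Real.exp (- u j) * u j ^ (a j - 1))
      = ∏ j, Real.Gamma (a j) := by
  rw [volume_pi, Measure.restrict_pi_pi]
  rw [integral_fintype_prod_eq_prod (f := fun j t => Real.exp (-t) * t ^ (a j - 1))]
  exact Finset.prod_congr rfl fun j _ => (Real.Gamma_eq_integral (ha j)).symm

lemma key {k : ℕ} {x : Fin (k + 1) → ℝ} (hx : StrictMono x) (a : Fin (k + 1) → ℝ)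
    (ha : ∀ j, 0 < a j) :
    ∏ j, Real.Gamma (a j) = Real.Gamma (∑ j, a j) *
      ∫ y in WO x, VV y / VV x * ∏ j, DAw x y j ^ (a j - 1) := by
  have hs : 0 < ∑ j, a j := Finset.sum_pos (fun j _ => ha j) univ_nonempty
  rw [Real.Gamma_eq_integral hs, ← SS_integral x (fun t => Real.exp (-t) * t ^ (∑ j, a j - 1))
    (fun y => VV y / VV x * ∏ j, DAw x y j ^ (a j - 1)), ← Gamma_prod a ha, ← ff_image hx,
    integral_image_eq_integral_abs_det_fderiv_smul volume (SS_meas x)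
      (fun v _ => (ff_hasFDerivAt x v).hasFDerivWithinAt) (ff_injOn hx)]
  refine setIntegral_congr_fun (SS_meas x) fun v hv => ?_
  have hd : |(Matrix.toLin' (JM x v)).toContinuousLinearMap.det|
      = v 0 ^ k * (VV (Fin.tail v) / VV x) := by
    rw [← JM_det hx hv, ContinuousLinearMap.det]
    simp [LinearMap.det_toLin']
  simp only [smul_eq_mul, hd]
  have h1 : ∀ j, Real.exp (-(ff x v j)) * ff x v j ^ (a j - 1)
      = Real.exp (-(ff x v j)) * (v 0 ^ (a j - 1) * DAw x (Fin.tail v) j ^ (a j - 1)) := by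
    intro j
    rw [ff, Real.mul_rpow hv.1.le (DAw_pos hx hv.2 j).le]
  simp only [h1, Finset.prod_mul_distrib]
  rw [← Real.exp_sum, ← Real.rpow_sum_of_pos hv.1]
  have h2 : ∑ j, -ff x v j = - v 0 := by
    simp only [ff, Finset.sum_neg_distrib, ← Finset.mul_sum, DAw_sum hx.injective, mul_one]
  have h3 : v 0 ^ (∑ j, a j - 1) = v 0 ^ k * v 0 ^ (∑ j, (a j - 1)) := by
    rw [← Real.rpow_natCast, ← Real.rpow_add hv.1]
    congr 1
    simp [Finset.sum_sub_distrib]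
    ring
  rw [h2, h3]
  ring

lemma key' {k : ℕ} {x : Fin (k + 1) → ℝ} (hx : StrictMono x) (a : Fin (k + 1) → ℝ)
    (ha : ∀ j, 0 < a j) :
    ∫ y in WO x, VV y / VV x * ∏ j, DAw x y j ^ (a j - 1)
      = (∏ j, Real.Gamma (a j)) / Real.Gamma (∑ j, a j) ∧
    IntegrableOn (fun y => VV y / VV x * ∏ j, DAw x y j ^ (a j - 1)) (WO x) := by
  have hs : 0 < ∑ j, a j := Finset.sum_pos (fun j _ => ha j) univ_nonempty
  have h := key hx a ha
  have hG := Real.Gamma_pos_of_pos hs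
  have h1 : ∫ y in WO x, VV y / VV x * ∏ j, DAw x y j ^ (a j - 1)
      = (∏ j, Real.Gamma (a j)) / Real.Gamma (∑ j, a j) := by
    rw [h]; field_simp
  refine ⟨h1, ?_⟩
  by_contra hni
  have h0 := integral_undef hni
  rw [h0] at h1
  have : 0 < (∏ j, Real.Gamma (a j)) / Real.Gamma (∑ j, a j) :=
    div_pos (Finset.prod_pos fun j _ => Real.Gamma_pos_of_pos (ha j)) hG
  linarith

lemma dens_eq {k : ℕ} {x : Fin (k + 1) → ℝ} (hx : StrictMono x) (β : ℝ) {y : Fin k → ℝ}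
    (hy : y ∈ WO x) : DAdensity k β x y
      = (Real.Gamma (∑ _j : Fin (k + 1), β / 2) / ∏ _j : Fin (k + 1), Real.Gamma (β / 2)) *
        (VV y / VV x * ∏ j, DAw x y j ^ (β / 2 - 1)) := by
  have hV := VV_pos x hx
  have c1 : (∑ _j : Fin (k + 1), β / 2) = β * (k + 1) / 2 := by
    simp; ring
  have c2 : (∏ _j : Fin (k + 1), Real.Gamma (β / 2)) = Real.Gamma (β / 2) ^ (k + 1) := by simp
  rw [c1, c2]
  unfold DAdensity
  have h1 : (∏ i : Fin (k + 1), ∏ j ∈ Ioi i, (x j - x i) ^ (1 - β)) = VV x ^ (1 - β) := by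
    unfold VV
    rw [← Real.finset_prod_rpow _ _ (fun i _ => Finset.prod_nonneg fun j hj =>
      (sub_pos.2 (hx (Finset.mem_Ioi.1 hj))).le)]
    refine Finset.prod_congr rfl fun i _ => ?_
    rw [← Real.finset_prod_rpow _ _ (fun j hj => (sub_pos.2 (hx (Finset.mem_Ioi.1 hj))).le)]
  have h2 : ∏ j, DAw x y j ^ (β / 2 - 1)
      = (∏ i : Fin k, ∏ j : Fin (k + 1), |y i - x j| ^ (β / 2 - 1)) / VV x ^ (β - 2) := by
    have e : ∀ j, DAw x y j ^ (β / 2 - 1) = |PP y univ (x j)| ^ (β / 2 - 1) /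
        |PP x (univ.erase j) (x j)| ^ (β / 2 - 1) := by
      intro j
      rw [← Real.div_rpow (abs_nonneg _) (abs_nonneg _), ← abs_div]
      congr 1
      exact (abs_of_pos (DAw_pos hx hy j)).symm
    simp only [e, Finset.prod_div_distrib]
    congr 1
    · rw [Finset.prod_comm]
      refine Finset.prod_congr rfl fun j _ => ?_
      unfold PP
      rw [Finset.abs_prod, ← Real.finset_prod_rpow _ _ (fun i _ => abs_nonneg _)]
      exact Finset.prod_congr rfl fun i _ => by rw [abs_sub_comm]
    · rw [Real.finset_prod_rpow _ _ (fun i _ => abs_nonneg _), VV_sq x hx, ← Real.rpow_natCast,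
        ← Real.rpow_mul hV.le]
      congr 1
      push_cast; ring
  have h3 : VV x ^ (1 - β) = 1 / (VV x * VV x ^ (β - 2)) := by
    rw [eq_div_iff (by positivity)]
    nth_rewrite 2 [← Real.rpow_one (VV x)]
    rw [← Real.rpow_add hV, ← Real.rpow_add hV]
    ring_nf
    simp
  rw [h1, h2, h3]
  change _ * _ * VV y * _ = _
  have : VV x ^ (β - 2) ≠ 0 := (Real.rpow_pos_of_pos hV _).ne'
  field_simp

lemma mono_int {k : ℕ} {x : Fin (k + 1) → ℝ} (hx : StrictMono x) (β : ℝ) (hβ : 0 < β)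
    (m : Fin (k + 1) →₀ ℕ) :
    IntegrableOn (fun y => DAdensity k β x y * MvPolynomial.eval (DAw x y) (MvPolynomial.monomial m 1)) (WO x) ∧
    ∫ y in WO x, DAdensity k β x y * MvPolynomial.eval (DAw x y) (MvPolynomial.monomial m 1)
      = EE (β / 2) (MvPolynomial.monomial m 1) := by
  obtain ⟨h1, h2⟩ := key' hx (fun j => β / 2 + m j) (fun j => by positivity)
  have he : Set.EqOn (fun y => DAdensity k β x y * MvPolynomial.eval (DAw x y) (MvPolynomial.monomial m 1))
      (fun y => (Real.Gamma (∑ _j : Fin (k + 1), β / 2) / ∏ _j : Fin (k + 1), Real.Gamma (β / 2)) *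
        (VV y / VV x * ∏ j, DAw x y j ^ (β / 2 + m j - 1))) (WO x) := by
    intro y hy
    simp only
    rw [dens_eq hx β hy, MvPolynomial.eval_monomial, one_mul, Finsupp.prod_fintype _ _ (by simp)]
    rw [mul_assoc, mul_assoc, ← Finset.prod_mul_distrib]
    congr 2
    refine Finset.prod_congr rfl fun j _ => ?_
    rw [← Real.rpow_natCast, ← Real.rpow_add (DAw_pos hx hy j)]
    congr 1; ring
  constructor
  · rw [integrableOn_congr_fun he (WO_meas x)]
    exact h2.const_mul _
  · rw [setIntegral_congr_fun (WO_meas x) he, integral_const_mul, h1, EE_monomial]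
    rfl

lemma poly_int {k : ℕ} {x : Fin (k + 1) → ℝ} (hx : StrictMono x) (β : ℝ) (hβ : 0 < β)
    (h : MvPolynomial (Fin (k + 1)) ℝ) :
    IntegrableOn (fun y => DAdensity k β x y * MvPolynomial.eval (DAw x y) h) (WO x) ∧
    ∫ y in WO x, DAdensity k β x y * MvPolynomial.eval (DAw x y) h = EE (β / 2) h := by
  induction h using MvPolynomial.induction_on' with
  | monomial m a =>
    obtain ⟨h1, h2⟩ := mono_int hx β hβ m
    have e : MvPolynomial.monomial m a = a • MvPolynomial.monomial m (1 : ℝ) := by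
      rw [MvPolynomial.smul_monomial, smul_eq_mul, mul_one]
    have e2 : (fun y => DAdensity k β x y * MvPolynomial.eval (DAw x y) (MvPolynomial.monomial m a))
      = fun y => a * (DAdensity k β x y * MvPolynomial.eval (DAw x y) (MvPolynomial.monomial m 1)) := by
      funext y
      rw [e, MvPolynomial.smul_eval]; ring
    rw [e2]
    refine ⟨h1.const_mul a, ?_⟩
    rw [integral_const_mul, h2, e, map_smul, smul_eq_mul]
  | add p q hp hq =>
    have e2 : (fun y => DAdensity k β x y * MvPolynomial.eval (DAw x y) (p + q))
      = fun y => DAdensity k β x y * MvPolynomial.eval (DAw x y) p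
        + DAdensity k β x y * MvPolynomial.eval (DAw x y) q := by
      funext y
      rw [map_add]; ring
    rw [e2]
    refine ⟨hp.1.add hq.1, ?_⟩
    rw [integral_add hp.1 hq.1, hp.2, hq.2, map_add]

lemma DAdomain_ae {k : ℕ} (x : Fin (k + 1) → ℝ) : WO x =ᵐ[volume] DAdomain k x := by
  have : DAdomain k x = Set.Icc (fun i : Fin k => x i.castSucc) (fun i : Fin k => x i.succ) := by
    ext y
    simp only [DAdomain, Set.mem_setOf_eq, Set.mem_Icc, Pi.le_def]
    exact forall_and
  rw [this]
  exact Measure.univ_pi_Ioo_ae_eq_Icc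

lemma dom_int {k : ℕ} {x : Fin (k + 1) → ℝ} (hx : StrictMono x) (β : ℝ) (hβ : 0 < β)
    (h : MvPolynomial (Fin (k + 1)) ℝ) (g : (Fin k → ℝ) → ℝ)
    (hg : ∀ y, StrictMono y → g y = MvPolynomial.eval (DAw x y) h) :
    ∫ y in DAdomain k x, DAdensity k β x y * g y = EE (β / 2) h := by
  rw [← setIntegral_congr_set (DAdomain_ae x), ← (poly_int hx β hβ h).2]
  refine setIntegral_congr_fun (WO_meas x) fun y hy => ?_
  rw [hg y (WO_strictMono hx hy)]


lemma coeff_mem {k : ℕ} (z : Fin (k + 1) → ℝ) (hz : Function.Injective z)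
    (p : Polynomial (MvPolynomial (Fin k) ℝ)) (hp : p.natDegree < k + 1)
    (A : Subalgebra ℝ (MvPolynomial (Fin k) ℝ))
    (hA : ∀ a, p.eval (MvPolynomial.C (z a)) ∈ A) (m : Fin (k + 1)) : p.coeff m ∈ A := by
  set V := Matrix.vandermonde z
  have hV : IsUnit V.det := isUnit_iff_ne_zero.2 (Matrix.det_vandermonde_ne_zero_iff.2 hz)
  have h1 : ∀ a, p.eval (MvPolynomial.C (z a)) = ∑ l : Fin (k + 1), V a l • p.coeff l := by
    intro a
    rw [Polynomial.eval_eq_sum_range' hp,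
      ← Fin.sum_univ_eq_sum_range (fun i => p.coeff i * MvPolynomial.C (z a) ^ i)]
    refine Finset.sum_congr rfl fun l _ => ?_
    rw [MvPolynomial.smul_eq_C_mul, show V a l = z a ^ (l : ℕ) from Matrix.vandermonde_apply z a l, map_pow, mul_comm]
  have h2 : p.coeff m = ∑ a, V⁻¹ m a • p.eval (MvPolynomial.C (z a)) := by
    simp only [h1, Finset.smul_sum, smul_smul]
    rw [Finset.sum_comm]
    simp only [← Finset.sum_smul]
    have : ∀ l, ∑ a, V⁻¹ m a * V a l = (1 : Matrix _ _ ℝ) m l := by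
      intro l
      rw [← Matrix.nonsing_inv_mul V hV, Matrix.mul_apply]
    simp [this, Matrix.one_apply]
  rw [h2]
  exact A.sum_mem fun a _ => A.smul_mem (hA a) _

lemma sym_gen {k : ℕ} (z : Fin (k + 1) → ℝ) (hz : Function.Injective z)
    (P : MvPolynomial (Fin k) ℝ) (hP : P.IsSymmetric) :
    ∃ F : MvPolynomial (Fin (k + 1)) ℝ,
      P = MvPolynomial.aeval (fun a => LL (id : Fin k → Fin k) univ (z a)) F := by
  set A := (MvPolynomial.aeval (R := ℝ) (fun a => LL (id : Fin k → Fin k) univ (z a))).range with hA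
  suffices P ∈ A by
    obtain ⟨F, hF⟩ := this
    exact ⟨F, hF.symm⟩
  have hes : ∀ j, j ≤ k → MvPolynomial.esymm (Fin k) ℝ j ∈ A := by
    intro j hj
    set p : Polynomial (MvPolynomial (Fin k) ℝ) :=
      ∏ i : Fin k, (Polynomial.X - Polynomial.C (MvPolynomial.X i)) with hp
    have hdeg : p.natDegree = k := by
      rw [hp, Polynomial.natDegree_prod_of_monic _ _ (fun i _ => Polynomial.monic_X_sub_C _)]
      simp
    have hc := coeff_mem z hz p (by omega) A (fun a => by
      refine ⟨MvPolynomial.X a, ?_⟩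
      simp [hp, LL, Polynomial.eval_prod]) ⟨k - j, by omega⟩
    have hv := Multiset.prod_X_sub_C_coeff
      ((univ : Finset (Fin k)).val.map (MvPolynomial.X : Fin k → MvPolynomial (Fin k) ℝ)) (k := k - j) (by simp)
    have hpp : (Multiset.map (fun t => Polynomial.X - Polynomial.C t)
        ((univ : Finset (Fin k)).val.map (MvPolynomial.X : Fin k → MvPolynomial (Fin k) ℝ))).prod = p := by
      rw [Multiset.map_map]; rfl
    rw [hpp] at hv
    simp only [Multiset.card_map, Finset.card_val, Finset.card_univ, Fintype.card_fin,
      Nat.sub_sub_self hj] at hv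
    rw [← MvPolynomial.esymm_eq_multiset_esymm] at hv
    have h3 : MvPolynomial.esymm (Fin k) ℝ j = (-1) ^ j * p.coeff (k - j) := by
      rw [hv, ← mul_assoc, ← mul_pow]; simp
    rw [h3]
    exact A.mul_mem (A.pow_mem (A.neg_mem A.one_mem) _) hc
  obtain ⟨G, hG⟩ := MvPolynomial.esymmAlgHom_surjective (σ := Fin k) ℝ (n := k) (by simp) ⟨P, hP⟩
  have hG' := congrArg Subtype.val hG
  rw [MvPolynomial.esymmAlgHom_apply] at hG'
  simp only at hG'
  rw [← hG']
  have : MvPolynomial.aeval (fun i : Fin k => MvPolynomial.esymm (Fin k) ℝ (i + 1)) G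
      = A.val (MvPolynomial.aeval (fun i : Fin k => (⟨MvPolynomial.esymm (Fin k) ℝ (i + 1), hes _ i.2⟩ : A)) G) := by
    exact Subalgebra.mvPolynomial_aeval_coe A (fun i : Fin k => (⟨MvPolynomial.esymm (Fin k) ℝ (i + 1), hes _ i.2⟩ : A)) G
  rw [this]
  exact Subtype.property _

/-- Intertwining of the Dyson Ornstein–Uhlenbeck generators `Ã^{(k)}` and `Ã^{(k+1)}` by the
Dixon–Anderson kernel on symmetric polynomials: for any symmetric polynomial `p` in `k`
variables there is a symmetric polynomial `q` in `k+1` variables with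
`q(x) = ∫_{W^{(k)}(x)} Λ^{(k)}(x,y) p(y) dy` and
`(Ã^{(k+1)}q)(x) = ∫_{W^{(k)}(x)} Λ^{(k)}(x,y) (Ã^{(k)}p)(y) dy`
for all strictly increasing `x ∈ ℝ^{k+1}`. -/
theorem DA_intertwines_OU_generators (β : ℝ) (hβ : 0 < β) (k : ℕ) (hk : 1 ≤ k)
    (P : MvPolynomial (Fin k) ℝ) (hP : P.IsSymmetric) :
    ∃ Q : MvPolynomial (Fin (k + 1)) ℝ, Q.IsSymmetric ∧
      (∀ x : Fin (k + 1) → ℝ, StrictMono x →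
        MvPolynomial.eval x Q =
          ∫ y in DAdomain k x, DAdensity k β x y * MvPolynomial.eval y P) ∧
      (∀ x : Fin (k + 1) → ℝ, StrictMono x →
        genOU (β / 2) (fun z => MvPolynomial.eval z Q) x =
          ∫ y in DAdomain k x,
            DAdensity k β x y * genOU (β / 2) (fun z => MvPolynomial.eval z P) y) := by
  set z : Fin (k + 1) → ℝ := fun a => ((a : ℕ) : ℝ) with hz
  have hzi : Function.Injective z := fun a b h => Fin.ext (by simpa [hz] using h)
  obtain ⟨F, hF⟩ := sym_gen z hzi P hP
  have hθ : 0 < β / 2 := by positivity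
  refine ⟨QQ (β / 2) z F, QQ_symm _ _ _, fun x hx => ?_, fun x hx => ?_⟩
  · rw [QQ_eval, dom_int hx β hβ (MvPolynomial.aeval (mm x z) F)]
    intro y _
    rw [hF, genA_aux z F y F, eval_mm x hx.injective y z F]
  · rw [QQ_gen _ hθ x hx.injective z F, dom_int hx β hβ (h2 (β / 2) x z F)]
    intro y hy
    rw [hF]
    exact P_gen (β / 2) x hx.injective y hy.injective z F
end

section
/- Fix β > 0 and an integer k ≥ 1, and let x = (x_1 < x_2 < … < x_{k+1}) ∈ ℝ^{k+1} be strictly increasing. Then the Dixon–Anderson density Λ^{(k)}(x,·) is nonnegative on W^{(k)}(x), is Lebesgue integrable there, and satisfies ∫_{W^{(k)}(x)} Λ^{(k)}(x,y) dy = 1; that is, Λ^{(k)}(x,·) is a probability density on W^{(k)}(x), so that L^{(k)}(x, dy) := Λ^{(k)}(x,y) dy defines a stochastic kernel. -/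
open Finset MeasureTheory

noncomputable def DAbord {n : ℕ} (x : Fin (n+1) → ℝ) (y : Fin n → ℝ) : Matrix (Fin (n+1)) (Fin (n+1)) ℝ :=
  Matrix.of fun i j => (Fin.cons 1 (fun j => (y j - x i)⁻¹) : Fin (n+1) → ℝ) j

noncomputable def DAvand {n : ℕ} (x : Fin n → ℝ) : ℝ := ∏ i, ∏ j ∈ Ioi i, (x j - x i)

lemma DAvand_succ {n : ℕ} (x : Fin (n+1) → ℝ) :
    DAvand x = (∏ i : Fin n, (x i.succ - x 0)) * DAvand (fun i => x i.succ) := by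
  simp [DAvand, Fin.prod_univ_succ, Fin.prod_Ioi_succ]

lemma DAbord_det {n : ℕ} (x : Fin (n+1) → ℝ) (y : Fin n → ℝ) (h : ∀ i j, y j - x i ≠ 0) :
    (DAbord x y).det = (∏ i : Fin n, (x i.succ - x 0)) * (∏ j, (y j - x 0)⁻¹) *
      (Matrix.of fun i j : Fin n => (y j - x i.succ)⁻¹).det := by
  have h1 : (DAbord x y).det = (Matrix.of fun i j => (Fin.cons (Fin.cons 1 (fun j => (y j - x 0)⁻¹) : Fin (n+1) → ℝ)
      (fun i => (Fin.cons 0 (fun j => (y j - x i.succ)⁻¹ - (y j - x 0)⁻¹) : Fin (n+1) → ℝ)) : Fin (n+1) → Fin (n+1) → ℝ) i j).det := by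
    apply Matrix.det_eq_of_forall_row_eq_smul_add_const (Fin.cons 0 1) 0
    · simp
    · intro i j
      refine Fin.cases ?_ (fun i => ?_) i <;> refine Fin.cases ?_ (fun j => ?_) j <;> simp [DAbord]
  rw [h1, Matrix.det_succ_column_zero, Fin.sum_univ_succ]
  simp only [Matrix.of_apply, Fin.cons_zero, Fin.cons_succ, mul_zero, zero_mul, Finset.sum_const_zero]
  simp only [Fin.val_zero, pow_zero, one_mul, add_zero]
  have h2 : Matrix.submatrix (Matrix.of fun i j => (Fin.cons (Fin.cons 1 (fun j => (y j - x 0)⁻¹) : Fin (n+1) → ℝ)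
      (fun i => (Fin.cons 0 (fun j => (y j - x i.succ)⁻¹ - (y j - x 0)⁻¹) : Fin (n+1) → ℝ)) : Fin (n+1) → Fin (n+1) → ℝ) i j)
      (Fin.succAbove 0) Fin.succ = Matrix.diagonal (fun i : Fin n => x i.succ - x 0) *
       (Matrix.of fun i j : Fin n => (y j - x i.succ)⁻¹) * Matrix.diagonal (fun j : Fin n => (y j - x 0)⁻¹) := by
    ext i j
    have := h 0 j
    have := h i.succ j
    simp only [Matrix.submatrix_apply, Matrix.mul_diagonal, Matrix.diagonal_mul, Matrix.of_apply, Fin.zero_succAbove, Fin.cons_succ]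
    field_simp
    ring
  rw [h2, Matrix.det_mul, Matrix.det_mul, Matrix.det_diagonal, Matrix.det_diagonal]
  ring

lemma DAcauchy_det {n : ℕ} (x y : Fin (n+1) → ℝ) (h : ∀ i j, y j - x i ≠ 0) :
    (Matrix.of fun i j : Fin (n+1) => (y j - x i)⁻¹).det =
      (∏ i, (y 0 - x i)⁻¹) * (∏ j : Fin n, (y 0 - y j.succ)) * (DAbord x (fun j => y j.succ)).det := by
  have h1 : (Matrix.of fun i j : Fin (n+1) => (y j - x i)⁻¹) =
      Matrix.diagonal (fun i => (y 0 - x i)⁻¹) * (Matrix.of fun i j : Fin (n+1) => (y 0 - x i) * (y j - x i)⁻¹) := by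
    ext i j
    have := h i 0
    simp only [Matrix.diagonal_mul, Matrix.of_apply]
    field_simp
  have h2 : (Matrix.of fun i j : Fin (n+1) => (y 0 - x i) * (y j - x i)⁻¹).det =
     (DAbord x (fun j => y j.succ) * Matrix.diagonal (Fin.cons 1 (fun j : Fin n => (y 0 - y j.succ)))).det := by
    rw [← Matrix.det_transpose, ← Matrix.det_transpose (DAbord _ _ * _)]
    apply Matrix.det_eq_of_forall_row_eq_smul_add_const (Fin.cons 0 1) 0
    · simp
    · intro j i
      have := h i 0
      have h3 := fun j => h i j
      refine Fin.cases ?_ (fun j => ?_) j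
      · simp [DAbord, Matrix.mul_diagonal, this]
      · have := h3 j.succ
        simp [DAbord, Matrix.mul_diagonal]
        field_simp
        ring
  rw [h1, Matrix.det_mul, h2, Matrix.det_mul, Matrix.det_diagonal, Matrix.det_diagonal, Fin.prod_univ_succ (Fin.cons _ _ : Fin (n+1) → ℝ)]
  simp only [Fin.cons_zero, Fin.cons_succ]
  ring

lemma DAbord_abs {n : ℕ} (x : Fin (n+1) → ℝ) (y : Fin n → ℝ) (h : ∀ i j, y j - x i ≠ 0) :
    |(DAbord x y).det| = |DAvand x| * |DAvand y| * ∏ j, ∏ i, |y j - x i|⁻¹ := by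
  induction n with
  | zero => simp [DAbord, DAvand]
  | succ n ih =>
    rw [DAbord_det x y h, DAcauchy_det _ _ (fun i j => h i.succ j), abs_mul, abs_mul, abs_mul, abs_mul,
      ih _ _ (fun i j => h i.succ j.succ), DAvand_succ x, DAvand_succ y]
    rw [Fin.prod_univ_succ (fun j => ∏ i, |y j - x i|⁻¹), Fin.prod_univ_succ (fun i => |y 0 - x i|⁻¹)]
    simp only [fun j => Fin.prod_univ_succ (fun i => |y j - x i|⁻¹), Finset.prod_mul_distrib]
    rw [Fin.prod_univ_succ (fun j => (y j - x 0)⁻¹)]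
    simp only [abs_mul, Finset.abs_prod, abs_inv, fun j : Fin n => abs_sub_comm (y 0) (y j.succ)]
    ring

noncomputable def DAp {k : ℕ} (x : Fin (k+1) → ℝ) (y : Fin k → ℝ) (i : Fin (k+1)) : ℝ :=
  ∏ j : Fin k, ((x i - y j) / (x i - x (i.succAbove j)))

def DAU {k : ℕ} (x : Fin (k+1) → ℝ) : Set (Fin k → ℝ) :=
  {y | ∀ j : Fin k, x j.castSucc < y j ∧ y j < x j.succ}

noncomputable def DAQ {k : ℕ} (x : Fin (k+1) → ℝ) (p : Fin (k+1) → ℝ) : Polynomial ℝ :=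
  ∑ i, Polynomial.C (p i) * ∏ j : Fin k, (Polynomial.X - Polynomial.C (x (i.succAbove j)))

lemma DAD_ne {k : ℕ} {x : Fin (k+1) → ℝ} (hx : StrictMono x) (i : Fin (k+1)) (j : Fin k) :
    x i - x (i.succAbove j) ≠ 0 :=
  sub_ne_zero.2 fun h => Fin.succAbove_ne i j (hx.injective h).symm

lemma DAU_ne {k : ℕ} {x : Fin (k+1) → ℝ} (hx : StrictMono x) {y : Fin k → ℝ} (hy : y ∈ DAU x)
    (i : Fin (k+1)) (j : Fin k) : 0 < (x i - y j) / (x i - x (i.succAbove j)) := by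
  rcases lt_or_ge j.castSucc i with h | h
  · rw [Fin.succAbove_of_castSucc_lt _ _ h]
    have h1 : x j.succ ≤ x i := hx.monotone (by simpa [Fin.le_def, Fin.lt_def] using h)
    have := (hy j).2
    have h2 := hx h
    exact div_pos (by linarith) (by linarith)
  · rw [Fin.succAbove_of_le_castSucc _ _ h]
    have h1 : x i ≤ x j.castSucc := hx.monotone h
    have := (hy j).1
    have h2 : x j.castSucc < x j.succ := hx (Fin.castSucc_lt_succ)
    exact div_pos_of_neg_of_neg (by linarith) (by linarith)

lemma DAp_pos {k : ℕ} {x : Fin (k+1) → ℝ} (hx : StrictMono x) {y : Fin k → ℝ} (hy : y ∈ DAU x)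
    (i : Fin (k+1)) : 0 < DAp x y i := Finset.prod_pos fun j _ => DAU_ne hx hy i j

lemma DAp_mul {k : ℕ} {x : Fin (k+1) → ℝ} (hx : StrictMono x) (y : Fin k → ℝ) (i : Fin (k+1)) :
    DAp x y i * ∏ j, (x i - x (i.succAbove j)) = ∏ j, (x i - y j) := by
  rw [DAp, ← Finset.prod_mul_distrib]
  exact Finset.prod_congr rfl fun j _ => div_mul_cancel₀ _ (DAD_ne hx i j)

lemma DAQ_eval {k : ℕ} (x p : Fin (k+1) → ℝ) (i : Fin (k+1)) :
    (DAQ x p).eval (x i) = p i * ∏ j, (x i - x (i.succAbove j)) := by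
  rw [DAQ, Polynomial.eval_finsetSum, Finset.sum_eq_single i]
  · simp [Polynomial.eval_prod]
  · intro l _ hl
    obtain ⟨j, hj⟩ := Fin.exists_succAbove_eq hl.symm
    simp only [Polynomial.eval_mul, Polynomial.eval_prod, Polynomial.eval_C, Polynomial.eval_sub, Polynomial.eval_X]
    rw [Finset.prod_eq_zero (Finset.mem_univ j) (by rw [hj, sub_self]), mul_zero]
  · simp

lemma DAprod_deg {k : ℕ} (y : Fin k → ℝ) :
    (∏ j : Fin k, (Polynomial.X - Polynomial.C (y j))).natDegree = k := by
  simp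

lemma DAprod_coeff {k : ℕ} (y : Fin k → ℝ) :
    (∏ j : Fin k, (Polynomial.X - Polynomial.C (y j))).coeff k = 1 := by
  have := Polynomial.monic_prod_X_sub_C y Finset.univ
  rw [Polynomial.Monic, Polynomial.leadingCoeff, DAprod_deg] at this
  exact this

lemma DAQ_deg {k : ℕ} (x p : Fin (k+1) → ℝ) : (DAQ x p).natDegree ≤ k := by
  refine Polynomial.natDegree_sum_le_of_forall_le _ _ fun i _ => ?_
  refine (Polynomial.natDegree_C_mul_le _ _).trans (DAprod_deg _).le

lemma DAQ_coeff {k : ℕ} (x p : Fin (k+1) → ℝ) : (DAQ x p).coeff k = ∑ i, p i := by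
  rw [DAQ, Polynomial.finsetSum_coeff]
  refine Finset.sum_congr rfl fun i _ => ?_
  rw [Polynomial.coeff_C_mul, DAprod_coeff, mul_one]

lemma DAQ_p {k : ℕ} {x : Fin (k+1) → ℝ} (hx : StrictMono x) (y : Fin k → ℝ) :
    DAQ x (DAp x y) = ∏ j : Fin k, (Polynomial.X - Polynomial.C (y j)) := by
  refine Polynomial.eq_of_degrees_lt_of_eval_index_eq (v := x) Finset.univ hx.injective.injOn ?_ ?_ ?_
  · refine lt_of_le_of_lt Polynomial.degree_le_natDegree ?_
    have := DAQ_deg x (DAp x y)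
    simp only [Finset.card_univ, Fintype.card_fin]
    exact_mod_cast Nat.lt_succ_of_le this
  · refine lt_of_le_of_lt Polynomial.degree_le_natDegree ?_
    rw [DAprod_deg]
    simp only [Finset.card_univ, Fintype.card_fin]
    exact_mod_cast Nat.lt_succ_self k
  · intro i _
    rw [DAQ_eval, DAp_mul hx]
    simp [Polynomial.eval_prod]

lemma DAp_sum {k : ℕ} {x : Fin (k+1) → ℝ} (hx : StrictMono x) (y : Fin k → ℝ) :
    ∑ i, DAp x y i = 1 := by
  rw [← DAQ_coeff x, DAQ_p hx, DAprod_coeff]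

lemma DAp_inj {k : ℕ} {x : Fin (k+1) → ℝ} (hx : StrictMono x) {y y' : Fin k → ℝ} (hy : y ∈ DAU x)
    (hy' : y' ∈ DAU x) (h : DAp x y = DAp x y') : y = y' := by
  have h1 := DAQ_p hx y
  rw [h, DAQ_p hx y'] at h1
  ext j
  have h2 := congrArg (Polynomial.eval (y j)) h1
  simp only [Polynomial.eval_prod, Polynomial.eval_sub, Polynomial.eval_X, Polynomial.eval_C] at h2
  rw [Finset.prod_eq_zero (f := fun l => y j - y l) (Finset.mem_univ j) (sub_self _), Finset.prod_eq_zero_iff] at h2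
  obtain ⟨l, _, hl⟩ := h2
  have a1 := hy j
  have a2 := hy' l
  rcases lt_trichotomy l j with hlj | hlj | hlj
  · have : x l.succ ≤ x j.castSucc := hx.monotone (Fin.succ_le_castSucc_iff.2 hlj)
    linarith
  · subst hlj; linarith
  · have : x j.succ ≤ x l.castSucc := hx.monotone (Fin.succ_le_castSucc_iff.2 hlj)
    linarith

lemma DAD_sign {k : ℕ} {x : Fin (k+1) → ℝ} (hx : StrictMono x) (m : Fin k) :
    (∏ j, (x m.castSucc - x (m.castSucc.succAbove j))) * (∏ j, (x m.succ - x (m.succ.succAbove j))) < 0 := by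
  obtain ⟨y, hy⟩ : ∃ y, y ∈ DAU x := by
    refine ⟨fun j => (x j.castSucc + x j.succ) / 2, fun j => ?_⟩
    have h2 : x j.castSucc < x j.succ := hx (Fin.castSucc_lt_succ)
    constructor <;> linarith
  have h1 := DAp_mul hx y m.castSucc
  have h2 := DAp_mul hx y m.succ
  have p1 := DAp_pos hx hy m.castSucc
  have p2 := DAp_pos hx hy m.succ
  have h3 : (∏ j, (x m.castSucc - y j)) * (∏ j, (x m.succ - y j)) < 0 := by
    rw [← Finset.prod_mul_distrib, ← Finset.mul_prod_erase _ _ (Finset.mem_univ m)]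
    refine mul_neg_of_neg_of_pos ?_ (Finset.prod_pos fun j hj => ?_)
    · have := hy m
      exact mul_neg_of_neg_of_pos (by linarith) (by linarith)
    · have hne := Finset.ne_of_mem_erase hj
      have a1 := hy j
      have h2 : x m.castSucc < x m.succ := hx (Fin.castSucc_lt_succ)
      rcases lt_or_gt_of_ne hne with hlj | hlj
      · have : x j.succ ≤ x m.castSucc := hx.monotone (Fin.succ_le_castSucc_iff.2 hlj)
        exact mul_pos (by linarith) (by linarith)
      · have : x m.succ ≤ x j.castSucc := hx.monotone (Fin.succ_le_castSucc_iff.2 hlj)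
        exact mul_pos_of_neg_of_neg (by linarith) (by linarith)
  rw [← h1, ← h2] at h3
  by_contra hc
  push Not at hc
  have := mul_nonneg (mul_pos p1 p2).le hc
  linarith

lemma DAp_surj {k : ℕ} {x : Fin (k+1) → ℝ} (hx : StrictMono x) (p : Fin (k+1) → ℝ) (hp : ∀ i, 0 < p i)
    (hs : ∑ i, p i = 1) : ∃ y ∈ DAU x, DAp x y = p := by
  have key : ∀ m : Fin k, ∃ t, (x m.castSucc < t ∧ t < x m.succ) ∧ (DAQ x p).eval t = 0 := by
    intro m
    have h2 : x m.castSucc < x m.succ := hx (Fin.castSucc_lt_succ)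
    have hneg : (DAQ x p).eval (x m.castSucc) * (DAQ x p).eval (x m.succ) < 0 := by
      rw [DAQ_eval, DAQ_eval]
      have := mul_neg_of_pos_of_neg (mul_pos (hp m.castSucc) (hp m.succ)) (DAD_sign hx m)
      linarith
    have hc : ContinuousOn (fun t => (DAQ x p).eval t) (Set.Icc (x m.castSucc) (x m.succ)) :=
      (DAQ x p).continuous.continuousOn
    rcases mul_neg_iff.1 hneg with h | h
    · obtain ⟨t, ht, h0⟩ := intermediate_value_Ioo' h2.le hc ⟨h.2, h.1⟩
      exact ⟨t, ht, h0⟩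
    · obtain ⟨t, ht, h0⟩ := intermediate_value_Ioo h2.le hc ⟨h.1, h.2⟩
      exact ⟨t, ht, h0⟩
  choose y hy hy0 using key
  have hyU : y ∈ DAU x := hy
  have hinj : Function.Injective y := by
    refine StrictMono.injective (fun l j hlj => ?_)
    have : x l.succ ≤ x j.castSucc := hx.monotone (Fin.succ_le_castSucc_iff.2 hlj)
    have a1 := hy l
    have a2 := hy j
    linarith
  refine ⟨y, hyU, ?_⟩
  have hQ : DAQ x p = ∏ j : Fin k, (Polynomial.X - Polynomial.C (y j)) := by
    refine Polynomial.eq_of_degree_sub_lt_of_eval_index_eq (v := y) Finset.univ hinj.injOn ?_ ?_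
    · simp only [Finset.card_univ, Fintype.card_fin]
      rw [Polynomial.degree_lt_iff_coeff_zero]
      intro n hn
      rw [Polynomial.coeff_sub]
      rcases hn.eq_or_lt with h | h
      · rw [← h, DAQ_coeff, DAprod_coeff, hs, sub_self]
      · rw [Polynomial.coeff_eq_zero_of_natDegree_lt ((DAQ_deg x p).trans_lt h),
          Polynomial.coeff_eq_zero_of_natDegree_lt ((DAprod_deg y).le.trans_lt h), sub_self]
    · intro j _
      rw [hy0, Polynomial.eval_prod, Finset.prod_eq_zero (Finset.mem_univ j)]
      simp
  ext i
  have h1 := DAp_mul hx y i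
  have h2 := DAQ_eval x p i
  rw [hQ, Polynomial.eval_prod] at h2
  simp only [Polynomial.eval_sub, Polynomial.eval_X, Polynomial.eval_C] at h2
  rw [h2] at h1
  exact mul_right_cancel₀ (Finset.prod_ne_zero_iff.2 fun j _ => DAD_ne hx i j) h1

noncomputable def DAF {k : ℕ} (x z : Fin (k+1) → ℝ) (i : Fin (k+1)) : ℝ :=
  z 0 * DAp x (fun j => z j.succ) i

noncomputable def DAA {k : ℕ} (x z : Fin (k+1) → ℝ) : Matrix (Fin (k+1)) (Fin (k+1)) ℝ :=
  Matrix.diagonal (DAF x z) * DAbord x (fun j => z j.succ) *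
    Matrix.diagonal (Fin.cons (z 0)⁻¹ (fun _ => 1))

def DAS {k : ℕ} (x : Fin (k+1) → ℝ) : Set (Fin (k+1) → ℝ) :=
  {z | 0 < z 0 ∧ (fun j : Fin k => z j.succ) ∈ DAU x}

lemma DAy_ne {k : ℕ} {x : Fin (k+1) → ℝ} (hx : StrictMono x) {y : Fin k → ℝ} (hy : y ∈ DAU x)
    (i : Fin (k+1)) (j : Fin k) : x i - y j ≠ 0 := by
  intro h
  have := DAU_ne hx hy i j
  rw [h] at this
  simp at this

lemma DAF_deriv {k : ℕ} {x : Fin (k+1) → ℝ} (hx : StrictMono x) {z : Fin (k+1) → ℝ} (hz : z ∈ DAS x) :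
    HasFDerivAt (DAF x) (LinearMap.toContinuousLinearMap (Matrix.toLin' (DAA x z))) z := by
  rw [hasFDerivAt_pi']
  intro i
  have hg : ∀ j ∈ (Finset.univ : Finset (Fin k)), HasFDerivAt (fun z : Fin (k+1) → ℝ => (x i - z j.succ) / (x i - x (i.succAbove j)))
      ((-(x i - x (i.succAbove j))⁻¹) • ContinuousLinearMap.proj (R := ℝ) (φ := fun _ : Fin (k+1) => ℝ) j.succ) z := by
    intro j _
    have h1 : HasFDerivAt (fun z : Fin (k+1) → ℝ => z j.succ)
       (ContinuousLinearMap.proj (R := ℝ) (φ := fun _ : Fin (k+1) => ℝ) j.succ) z := hasFDerivAt_apply _ _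
    have h2 := (h1.const_sub (x i)).mul_const (x i - x (i.succAbove j))⁻¹
    simp only [← div_eq_mul_inv] at h2
    refine h2.congr_fderiv ?_
    ext v
    simp
  have h0 : HasFDerivAt (fun z : Fin (k+1) → ℝ => z 0)
       (ContinuousLinearMap.proj (R := ℝ) (φ := fun _ : Fin (k+1) => ℝ) 0) z := hasFDerivAt_apply _ _
  have h := h0.mul (HasFDerivAt.finsetProd hg)
  refine h.congr_fderiv ?_
  ext v
  have hz0 : z 0 ≠ 0 := hz.1.ne'
  simp only [_root_.add_apply, _root_.smul_apply, _root_.sum_apply,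
    ContinuousLinearMap.proj_apply, ContinuousLinearMap.comp_apply, LinearMap.coe_toContinuousLinearMap',
    Matrix.toLin'_apply, Matrix.mulVec, dotProduct, smul_eq_mul, DAA, Matrix.mul_diagonal, Matrix.diagonal_mul]
  rw [Fin.sum_univ_succ, add_comm]
  congr 1
  · simp only [DAbord, DAF, DAp, Matrix.of_apply, Fin.cons_zero]
    field_simp
  · rw [Finset.mul_sum]
    refine Finset.sum_congr rfl fun j _ => ?_
    have e := Finset.mul_prod_erase Finset.univ (fun j => (x i - z j.succ) / (x i - x (i.succAbove j))) (Finset.mem_univ j)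
    simp only [DAbord, DAF, DAp, Matrix.of_apply, Fin.cons_succ]
    rw [← e]
    have n1 := DAD_ne hx i j
    have n2 : x i - z j.succ ≠ 0 := DAy_ne hx hz.2 i j
    have n3 : z j.succ - x i ≠ 0 := by intro h; apply n2; linarith
    field_simp
    ring

lemma DAF_det {k : ℕ} {x : Fin (k+1) → ℝ} (hx : StrictMono x) {z : Fin (k+1) → ℝ} (hz : z ∈ DAS x) :
    |(LinearMap.toContinuousLinearMap (Matrix.toLin' (DAA x z))).det| =
      (∏ i, DAF x z i) * (z 0)⁻¹ * (|DAvand x| * |DAvand fun j : Fin k => z j.succ| *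
        ∏ j : Fin k, ∏ i, |z j.succ - x i|⁻¹) := by
  have hF : ∀ i, 0 < DAF x z i := fun i => mul_pos hz.1 (DAp_pos hx hz.2 i)
  have : (LinearMap.toContinuousLinearMap (Matrix.toLin' (DAA x z))).det = (DAA x z).det := by
    simp [ContinuousLinearMap.det]
  rw [this, DAA, Matrix.det_mul, Matrix.det_mul, abs_mul, abs_mul, Matrix.det_diagonal, Matrix.det_diagonal,
    DAbord_abs, Fin.prod_univ_succ (Fin.cons _ _ : Fin (k+1) → ℝ)]
  · simp only [Fin.cons_zero, Fin.cons_succ, Finset.prod_const_one, mul_one]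
    rw [abs_of_pos (Finset.prod_pos fun i _ => hF i), abs_of_pos (inv_pos.2 hz.1)]
    ring
  · intro i j h
    exact DAy_ne hx hz.2 i j (by linarith)

lemma DAF_sum {k : ℕ} {x : Fin (k+1) → ℝ} (hx : StrictMono x) (z : Fin (k+1) → ℝ) :
    ∑ i, DAF x z i = z 0 := by
  simp only [DAF]
  rw [← Finset.mul_sum, DAp_sum hx, mul_one]

lemma DAF_inj {k : ℕ} {x : Fin (k+1) → ℝ} (hx : StrictMono x) : Set.InjOn (DAF x) (DAS x) := by
  intro z hz z' hz' h
  have h0 : z 0 = z' 0 := by rw [← DAF_sum hx z, h, DAF_sum hx]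
  have h1 : DAp x (fun j => z j.succ) = DAp x (fun j => z' j.succ) := by
    ext i
    have := congrFun h i
    simp only [DAF, h0] at this
    exact mul_left_cancel₀ hz'.1.ne' this
  have h2 := DAp_inj hx hz.2 hz'.2 h1
  ext i
  refine Fin.cases h0 (fun j => congrFun h2 j) i

lemma DAF_image {k : ℕ} {x : Fin (k+1) → ℝ} (hx : StrictMono x) :
    DAF x '' (DAS x) = Set.pi Set.univ fun _ => Set.Ioi 0 := by
  ext w
  simp only [Set.mem_image, Set.mem_pi, Set.mem_univ, true_imp_iff, Set.mem_Ioi]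
  constructor
  · rintro ⟨z, hz, rfl⟩ i
    exact mul_pos hz.1 (DAp_pos hx hz.2 i)
  · intro hw
    have hr : 0 < ∑ i, w i := Finset.sum_pos (fun i _ => hw i) ⟨0, Finset.mem_univ _⟩
    obtain ⟨y, hy, hp⟩ := DAp_surj hx (fun i => w i / ∑ i, w i) (fun i => div_pos (hw i) hr)
      (by rw [← Finset.sum_div, div_self hr.ne'])
    refine ⟨Fin.cons (∑ i, w i) y, ⟨by simpa using hr, by simpa using hy⟩, ?_⟩
    ext i
    simp only [DAF, Fin.cons_zero, Fin.cons_succ]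
    rw [hp]
    field_simp

lemma DAsucc_prod {k : ℕ} (x : Fin (k+1) → ℝ) :
    ∏ i, ∏ j, |x i - x (i.succAbove j)| = |DAvand x| ^ 2 := by
  induction k with
  | zero => simp [DAvand]
  | succ k ih =>
    rw [Fin.prod_univ_succ, DAvand_succ]
    simp only [Fin.zero_succAbove]
    have : ∀ i : Fin (k+1), ∏ j, |x i.succ - x (i.succ.succAbove j)| =
        |x i.succ - x 0| * ∏ j : Fin k, |x i.succ - x (i.succAbove j).succ| := by
      intro i
      rw [Fin.prod_univ_succ]
      simp
    simp only [this, Finset.prod_mul_distrib]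
    rw [ih (fun i => x i.succ)]
    simp only [fun i : Fin (k+1) => abs_sub_comm (x 0) (x i.succ), abs_mul, Finset.abs_prod]
    ring

noncomputable def DAE {k : ℕ} (β : ℝ) (x : Fin (k + 1) → ℝ) (y : Fin k → ℝ) : ℝ :=
    (∏ i : Fin (k + 1), ∏ j ∈ Ioi i, (x j - x i) ^ (1 - β)) *
    (∏ i : Fin k, ∏ j ∈ Ioi i, (y j - y i)) *
    (∏ i : Fin k, ∏ j : Fin (k + 1), |y i - x j| ^ (β / 2 - 1))

lemma DAvand_pos {k : ℕ} {x : Fin k → ℝ} (hx : StrictMono x) : 0 < DAvand x :=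
  Finset.prod_pos fun _ _ => Finset.prod_pos fun _ hj => sub_pos.2 (hx (Finset.mem_Ioi.1 hj))

lemma DAU_mono {k : ℕ} {x : Fin (k+1) → ℝ} (hx : StrictMono x) {y : Fin k → ℝ} (hy : y ∈ DAU x) :
    StrictMono y := by
  intro l j hlj
  have : x l.succ ≤ x j.castSucc := hx.monotone (Fin.succ_le_castSucc_iff.2 hlj)
  have a1 := hy l
  have a2 := hy j
  linarith

lemma DA_integrand {k : ℕ} {β : ℝ} {x : Fin (k+1) → ℝ} (hx : StrictMono x)
    {z : Fin (k+1) → ℝ} (hz : z ∈ DAS x) :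
    |(LinearMap.toContinuousLinearMap (Matrix.toLin' (DAA x z))).det| *
      ∏ i, (Real.exp (-(DAF x z i)) * (DAF x z i) ^ (β / 2 - 1)) =
    (Real.exp (-(z 0)) * (z 0) ^ (β * (k + 1) / 2 - 1)) * DAE β x (fun j => z j.succ) := by
  have hz0 : 0 < z 0 := hz.1
  have hy : (fun j : Fin k => z j.succ) ∈ DAU x := hz.2
  have hF : ∀ i, 0 < DAF x z i := fun i => mul_pos hz.1 (DAp_pos hx hz.2 i)
  have hV := DAvand_pos hx
  have hVy := DAvand_pos (DAU_mono hx hy)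
  have hne : ∀ i j, 0 < |z (Fin.succ j) - x i| := fun i j => abs_pos.2 fun h =>
    DAy_ne hx hy i j (by linarith)
  have hE : 0 < ∏ j : Fin k, ∏ i, |z j.succ - x i| :=
    Finset.prod_pos fun j _ => Finset.prod_pos fun i _ => hne i j
  have hP : ∏ i, DAF x z i = z 0 ^ (k+1) * ((∏ j : Fin k, ∏ i, |z j.succ - x i|) / DAvand x ^ 2) := by
    simp only [DAF]
    rw [Finset.prod_mul_distrib, Finset.prod_const, Finset.card_univ, Fintype.card_fin]
    congr 1
    rw [← abs_of_pos hV, ← DAsucc_prod, Finset.prod_comm, ← Finset.prod_div_distrib]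
    refine Finset.prod_congr rfl fun i _ => ?_
    rw [← abs_of_pos (DAp_pos hx hy i), DAp, Finset.abs_prod, ← Finset.prod_div_distrib]
    refine Finset.prod_congr rfl fun j _ => ?_
    rw [abs_div, abs_sub_comm (z j.succ)]
  have h1 : ∏ i, (DAF x z i) ^ (β / 2 - 1) = (∏ i, DAF x z i) ^ (β / 2 - 1) :=
    Real.finsetProd_rpow _ _ (fun i _ => (hF i).le) _
  have h2 : (∏ i : Fin (k + 1), ∏ j ∈ Ioi i, (x j - x i) ^ (1 - β)) = DAvand x ^ (1 - β) := by
    rw [DAvand, ← Real.finsetProd_rpow]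
    · refine Finset.prod_congr rfl fun i _ => Real.finsetProd_rpow _ _ ?_ _
      intro j hj
      exact (sub_pos.2 (hx (Finset.mem_Ioi.1 hj))).le
    · intro i _
      exact Finset.prod_nonneg fun j hj => (sub_pos.2 (hx (Finset.mem_Ioi.1 hj))).le
  have h3 : (∏ i : Fin k, ∏ j : Fin (k + 1), |z i.succ - x j| ^ (β / 2 - 1)) =
      (∏ j : Fin k, ∏ i, |z j.succ - x i|) ^ (β / 2 - 1) := by
    rw [← Real.finsetProd_rpow]
    · refine Finset.prod_congr rfl fun i _ => Real.finsetProd_rpow _ _ ?_ _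
      intro j hj
      positivity
    · intro i _
      positivity
  have h4 : (∏ i : Fin k, ∏ j ∈ Ioi i, (z j.succ - z i.succ)) = DAvand fun j : Fin k => z j.succ := rfl
  rw [DAF_det hx hz, Finset.prod_mul_distrib, h1, ← Real.exp_sum, Finset.sum_neg_distrib, DAF_sum hx, DAE, h2, h3, h4,
    abs_of_pos hV, abs_of_pos hVy]
  simp only [Finset.prod_inv_distrib]
  rw [hP]
  generalize (∏ j : Fin k, ∏ i, |z j.succ - x i|) = E at *
  generalize DAvand x = V at *
  generalize (DAvand fun j : Fin k => z j.succ) = Y at *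
  generalize z 0 = r at *
  have e1 : (r ^ (k+1) * (E / V ^ 2)) ^ (β / 2 - 1) =
      r ^ ((k+1) * (β/2 - 1)) * (E ^ (β / 2 - 1) * V ^ (-(2 * (β / 2 - 1)))) := by
    rw [Real.mul_rpow (by positivity) (by positivity), Real.div_rpow (by positivity) (by positivity),
      ← Real.rpow_natCast r, ← Real.rpow_natCast V, ← Real.rpow_mul hz0.le, ← Real.rpow_mul hV.le,
      Real.rpow_neg hV.le]
    push_cast
    rw [div_eq_mul_inv (E ^ _)]
  have e2 : r ^ (β * (k + 1) / 2 - 1) = r ^ ((k+1) * (β/2 - 1)) * r ^ (k+1) * r⁻¹ := by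
    rw [← Real.rpow_natCast r, ← Real.rpow_neg_one r, ← Real.rpow_add hz0, ← Real.rpow_add hz0]
    congr 1
    push_cast
    ring
  have e3 : V ^ (1 - β) = V ^ (-(2 * (β / 2 - 1))) * (V ^ 2)⁻¹ * V := by
    have : V ^ (1 - β) = V ^ (-(2 * (β / 2 - 1)) + (-1)) := by congr 1; ring
    rw [this, Real.rpow_add hV, Real.rpow_neg_one]
    field_simp
  rw [e1, e2, e3]
  field_simp

lemma DA_gamma1 {s : ℝ} (hs : 0 < s) :
    ∫⁻ r in Set.Ioi (0:ℝ), ENNReal.ofReal (Real.exp (-r) * r ^ (s - 1)) = ENNReal.ofReal (Real.Gamma s) := by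
  rw [Real.Gamma_eq_integral hs, ofReal_integral_eq_lintegral_ofReal (Real.GammaIntegral_convergent hs)]
  refine (ae_restrict_iff' measurableSet_Ioi).2 (Filter.Eventually.of_forall fun r hr => ?_)
  have : (0:ℝ) < r := hr
  simp only [Pi.zero_apply]
  positivity

lemma DA_gamman {s : ℝ} (hs : 0 < s) (n : ℕ) :
    ∫⁻ w in (Set.pi Set.univ fun _ : Fin n => Set.Ioi (0:ℝ)),
      ENNReal.ofReal (∏ i, (Real.exp (-(w i)) * (w i) ^ (s - 1))) = ENNReal.ofReal (Real.Gamma s ^ n) := by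
  have hm : MeasurableSet (Set.pi Set.univ fun _ : Fin n => Set.Ioi (0:ℝ)) :=
    MeasurableSet.univ_pi fun _ => measurableSet_Ioi
  have hI : (volume.restrict (Set.pi Set.univ fun _ : Fin n => Set.Ioi (0:ℝ))) =
      Measure.pi (fun _ : Fin n => (volume : Measure ℝ).restrict (Set.Ioi 0)) := by
    rw [volume_pi, Measure.restrict_pi_pi]
  rw [← ofReal_integral_eq_lintegral_ofReal]
  · rw [hI, integral_fintype_prod_eq_pow (ι := Fin n) (fun r : ℝ => Real.exp (-r) * r ^ (s - 1)),
      ← Real.Gamma_eq_integral hs, Fintype.card_fin]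
  · rw [hI]
    exact Integrable.fintype_prod (f := fun _ r => Real.exp (-r) * r ^ (s - 1)) fun _ => Real.GammaIntegral_convergent hs
  · refine (ae_restrict_iff' hm).2 (Filter.Eventually.of_forall fun w hw => ?_)
    simp only [Pi.zero_apply]
    refine Finset.prod_nonneg fun i _ => ?_
    have : (0:ℝ) < w i := hw i (Set.mem_univ _)
    positivity

lemma DAU_eq {k : ℕ} (x : Fin (k+1) → ℝ) :
    DAU x = Set.pi Set.univ fun j : Fin k => Set.Ioo (x j.castSucc) (x j.succ) := by
  ext y; simp [DAU]

lemma DAU_meas {k : ℕ} (x : Fin (k+1) → ℝ) : MeasurableSet (DAU x) := by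
  rw [DAU_eq]; exact MeasurableSet.univ_pi fun _ => measurableSet_Ioo

lemma DAE_meas {k : ℕ} (β : ℝ) (x : Fin (k+1) → ℝ) : Measurable (DAE β x) := by
  unfold DAE
  fun_prop

lemma DA_lint {k : ℕ} {β : ℝ} (hβ : 0 < β) {x : Fin (k+1) → ℝ} (hx : StrictMono x) :
    ENNReal.ofReal (Real.Gamma (β * (k + 1) / 2)) * ∫⁻ y in DAU x, ENNReal.ofReal (DAE β x y) =
      ENNReal.ofReal (Real.Gamma (β / 2) ^ (k + 1)) := by
  let e := MeasurableEquiv.piFinSuccAbove (fun _ : Fin (k+1) => ℝ) 0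
  have he : MeasurePreserving e volume volume := volume_preserving_piFinSuccAbove (fun _ : Fin (k+1) => ℝ) 0
  have hS : DAS x = e ⁻¹' (Set.Ioi 0 ×ˢ DAU x) := by
    ext z
    simp [DAS, e, MeasurableEquiv.piFinSuccAbove, Fin.insertNthEquiv, DAU, Fin.tail]
  have hSm : MeasurableSet (DAS x) := by
    rw [hS]; exact e.measurable (measurableSet_Ioi.prod (DAU_meas x))
  rw [← DA_gamman (s := β / 2) (by positivity) (k+1), ← DAF_image hx,
    lintegral_image_eq_lintegral_abs_det_fderiv_mul volume hSm
      (fun z hz => (DAF_deriv hx hz).hasFDerivWithinAt) (DAF_inj hx)]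
  have h1 : ∀ z ∈ DAS x, ENNReal.ofReal |(LinearMap.toContinuousLinearMap (Matrix.toLin' (DAA x z))).det| *
      ENNReal.ofReal (∏ i, (Real.exp (-(DAF x z i)) * (DAF x z i) ^ (β / 2 - 1))) =
      (fun q : ℝ × (Fin k → ℝ) => ENNReal.ofReal (Real.exp (-q.1) * q.1 ^ (β * (k + 1) / 2 - 1)) * ENNReal.ofReal (DAE β x q.2)) (e z) := by
    intro z hz
    have hz0 : 0 < z 0 := hz.1
    rw [← ENNReal.ofReal_mul (abs_nonneg _), DA_integrand hx hz, ENNReal.ofReal_mul (by positivity)]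
    rfl
  have h2 := he.setLIntegral_comp_preimage_emb e.measurableEmbedding (fun q : ℝ × (Fin k → ℝ) =>
    ENNReal.ofReal (Real.exp (-q.1) * q.1 ^ (β * (k + 1) / 2 - 1)) * ENNReal.ofReal (DAE β x q.2))
    (Set.Ioi 0 ×ˢ DAU x)
  rw [setLIntegral_congr_fun hSm h1, hS]
  refine Eq.trans ?_ h2.symm
  rw [
    Measure.volume_eq_prod, ← Measure.prod_restrict,
    lintegral_prod_mul (f := fun r : ℝ => ENNReal.ofReal (Real.exp (-r) * r ^ (β * (k + 1) / 2 - 1)))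
      (g := fun y => ENNReal.ofReal (DAE β x y)), DA_gamma1 (by positivity)]
  · fun_prop
  · exact (DAE_meas β x).ennreal_ofReal.aemeasurable

theorem DAdensity_probability (β : ℝ) (hβ : 0 < β) (k : ℕ) (hk : 1 ≤ k)
    (x : Fin (k + 1) → ℝ) (hx : StrictMono x) :
    (∀ y ∈ DAdomain k x, 0 ≤ DAdensity k β x y) ∧
    IntegrableOn (DAdensity k β x) (DAdomain k x) volume ∧
    ∫ y in DAdomain k x, DAdensity k β x y = 1 := by
  have hG1 : 0 < Real.Gamma (β * (k + 1) / 2) := Real.Gamma_pos_of_pos (by positivity)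
  have hG2 : 0 < Real.Gamma (β / 2) := Real.Gamma_pos_of_pos (by positivity)
  have hc : 0 < Real.Gamma (β * (k + 1) / 2) / Real.Gamma (β / 2) ^ (k + 1) := by positivity
  have hE : ∀ y, DAdensity k β x y = (Real.Gamma (β * (k + 1) / 2) / Real.Gamma (β / 2) ^ (k + 1)) * DAE β x y := by
    intro y
    simp only [DAdensity, DAE]
    ring
  have h0 : ∀ y ∈ DAdomain k x, 0 ≤ DAdensity k β x y := by
    intro y hy
    rw [hE]
    refine mul_nonneg hc.le (mul_nonneg (mul_nonneg ?_ ?_) ?_)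
    · exact Finset.prod_nonneg fun i _ => Finset.prod_nonneg fun j hj =>
        Real.rpow_nonneg (sub_pos.2 (hx (Finset.mem_Ioi.1 hj))).le _
    · refine Finset.prod_nonneg fun i _ => Finset.prod_nonneg fun j hj => ?_
      have : x i.succ ≤ x j.castSucc := hx.monotone (Fin.succ_le_castSucc_iff.2 (Finset.mem_Ioi.1 hj))
      have a1 := hy i
      have a2 := hy j
      linarith
    · exact Finset.prod_nonneg fun i _ => Finset.prod_nonneg fun j hj => by positivity
  have hdom : DAdomain k x = Set.Icc (fun j : Fin k => x j.castSucc) (fun j => x j.succ) := by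
    ext y
    simp [DAdomain, Pi.le_def, forall_and]
  have hae : DAU x =ᵐ[volume] DAdomain k x := by
    rw [hdom, DAU_eq, volume_pi]
    exact Measure.univ_pi_Ioo_ae_eq_Icc
  have hmD : MeasurableSet (DAdomain k x) := by rw [hdom]; exact measurableSet_Icc
  have hm : Measurable (DAdensity k β x) := by
    rw [funext hE]; exact (DAE_meas β x).const_mul _
  have hl : ∫⁻ y in DAdomain k x, ENNReal.ofReal (DAdensity k β x y) = 1 := by
    rw [← setLIntegral_congr hae]
    simp only [hE, ENNReal.ofReal_mul hc.le]
    rw [lintegral_const_mul _ (DAE_meas β x).ennreal_ofReal, ENNReal.ofReal_div_of_pos (by positivity),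
      div_eq_mul_inv, mul_right_comm, DA_lint hβ hx]
    refine ENNReal.mul_inv_cancel ?_ ENNReal.ofReal_ne_top
    rw [Ne, ENNReal.ofReal_eq_zero, not_le]
    positivity
  have hnn : 0 ≤ᵐ[volume.restrict (DAdomain k x)] DAdensity k β x :=
    (ae_restrict_iff' hmD).2 (Filter.Eventually.of_forall h0)
  refine ⟨h0, ⟨hm.aestronglyMeasurable, ?_⟩, ?_⟩
  · rw [hasFiniteIntegral_iff_ofReal hnn, hl]
    exact ENNReal.one_lt_top
  · rw [integral_eq_lintegral_of_nonneg_ae hnn hm.aestronglyMeasurable, hl]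
    simp
end

section
/- Let θ > 0, let k ≥ 1, and let p be a symmetric polynomial in k real variables of total degree d. Then there exists a symmetric polynomial q in k real variables of total degree at most d − 2 (with q = 0 if d < 2) such that for every z ∈ ℝ^k with pairwise distinct coordinates, (A^{(k)}p)(z) = q(z), where (A^{(k)}p)(z) := (1/2) Σ_{i=1}^k ∂²p/∂z_i²(z) + θ Σ_{i=1}^k Σ_{j≠i} (1/(z_i−z_j)) ∂p/∂z_i(z). In particular, the Dyson Brownian motion generator A^{(k)} maps symmetric polynomials to symmetric polynomials, lowering the degree by at least two. -/
open Finset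

open MvPolynomial in
lemma aux_hasFDeriv {k : ℕ} (P : MvPolynomial (Fin k) ℝ) (z : Fin k → ℝ) :
    DifferentiableAt ℝ (fun w => eval w P) z ∧
    ∀ i, fderiv ℝ (fun w => eval w P) z (Pi.single i 1) = eval z (pderiv i P) := by
  induction P using MvPolynomial.induction_on with
  | C a => simp
  | add p q hp hq =>
    simp only [map_add]
    refine ⟨hp.1.add hq.1, fun i => ?_⟩
    rw [fderiv_fun_add hp.1 hq.1, ← hp.2, ← hq.2]; rfl
  | mul_X p j hp =>
    have hX : HasFDerivAt (fun w : Fin k → ℝ => w j) (ContinuousLinearMap.proj (R := ℝ) (φ := fun _ : Fin k => ℝ) j) z :=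
      hasFDerivAt_apply j z
    simp only [map_mul, eval_X]
    refine ⟨hp.1.mul hX.differentiableAt, fun i => ?_⟩
    rw [(hp.1.hasFDerivAt.fun_mul hX).fderiv]
    simp [hp.2, pderiv_X, Pi.single_apply]
    by_cases h : j = i
    · subst h; simp
    · simp [h]

open MvPolynomial in
lemma aux_deg {k : ℕ} (P : MvPolynomial (Fin k) ℝ) (i : Fin k) :
    pderiv i P = 0 ∨ (pderiv i P).totalDegree + 1 ≤ P.totalDegree := by
  by_cases h : pderiv i P = 0
  · exact Or.inl h
  right
  obtain ⟨m, hm, hd⟩ := Finset.exists_mem_eq_sup (pderiv i P).support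
    (by simpa using h) (fun s => s.sum fun _ e => e)
  have h1 : m + Finsupp.single i 1 ∈ P.support := by
    rw [mem_support_iff, coeff_pderiv] at hm
    exact mem_support_iff.2 (left_ne_zero_of_mul hm)
  have h2 := le_totalDegree h1
  rw [Finsupp.sum_add_index' (by simp) (by simp)] at h2
  simp only [Finsupp.sum_single_index] at h2
  unfold totalDegree at h2 ⊢
  rw [hd]; exact h2

open MvPolynomial in
lemma aux_dvd {k : ℕ} (i j : Fin k) (F : MvPolynomial (Fin k) ℝ) :
    (X i - X j) ∣ F - rename (Equiv.swap i j) F := by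
  induction F using MvPolynomial.induction_on with
  | C a => simp
  | add p q hp hq =>
    have := dvd_add hp hq
    rw [map_add]; convert this using 1; ring
  | mul_X p l hp =>
    rw [map_mul, rename_X]
    have h2 : (X i - X j : MvPolynomial (Fin k) ℝ) ∣ X l - X (Equiv.swap i j l) := by
      rcases eq_or_ne l i with rfl | h
      · simp
      rcases eq_or_ne l j with rfl | h'
      · rw [Equiv.swap_apply_right]
        exact ⟨-1, by ring⟩
      · simp [Equiv.swap_apply_of_ne_of_ne h h']
    have := dvd_add (hp.mul_right (X l)) (h2.mul_left (rename (Equiv.swap i j) p))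
    convert this using 1; ring

open MvPolynomial in
lemma aux_sub_ne {k : ℕ} {i j : Fin k} (h : i ≠ j) :
    (X i - X j : MvPolynomial (Fin k) ℝ) ≠ 0 :=
  sub_ne_zero.2 fun e => h (X_injective e)

open MvPolynomial in
lemma aux_sub_deg {k : ℕ} {i j : Fin k} (h : i ≠ j) :
    1 ≤ (X i - X j : MvPolynomial (Fin k) ℝ).totalDegree := by
  have h1 : Finsupp.single i 1 ∈ (X i - X j : MvPolynomial (Fin k) ℝ).support := by
    rw [mem_support_iff, coeff_sub, coeff_X, coeff_X, if_pos rfl, if_neg]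
    · simp
    · intro e
      exact h (Finsupp.single_left_injective one_ne_zero e).symm
  simpa using le_totalDegree h1

open MvPolynomial in
theorem dyson_generator_maps_symmetric_polynomials (θ : ℝ) (hθ : 0 < θ) (k : ℕ) (hk : 1 ≤ k)
    (P : MvPolynomial (Fin k) ℝ) (hP : P.IsSymmetric) :
    ∃ Q : MvPolynomial (Fin k) ℝ, Q.IsSymmetric ∧
      Q.totalDegree ≤ P.totalDegree - 2 ∧
      (P.totalDegree < 2 → Q = 0) ∧
      ∀ z : Fin k → ℝ, Function.Injective z →
        genA θ (fun w => MvPolynomial.eval w P) z = MvPolynomial.eval z Q := by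
  have hD : ∀ (σ : Equiv.Perm (Fin k)) i, rename σ (pderiv i P) = pderiv (σ i) P := by
    intro σ i
    rw [← pderiv_rename σ.injective, hP σ]
  have hR : ∀ i j : Fin k, ∃ R : MvPolynomial (Fin k) ℝ,
      pderiv i P - pderiv j P = (X i - X j) * R ∧ (i = j → R = 0) := by
    intro i j
    by_cases h : i = j
    · exact ⟨0, by simp [h]⟩
    · obtain ⟨R, hR⟩ := aux_dvd i j (pderiv i P)
      rw [hD, Equiv.swap_apply_left] at hR
      exact ⟨R, hR, fun e => absurd e h⟩
  choose R hR hR0 using hR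
  have hRs : ∀ (σ : Equiv.Perm (Fin k)) i j, rename σ (R i j) = R (σ i) (σ j) := by
    intro σ i j
    by_cases h : i = j
    · rw [hR0 _ _ h, hR0 _ _ (congrArg σ h), map_zero]
    · have e := congrArg (rename σ) (hR i j)
      rw [map_sub, hD, hD, hR, map_mul, map_sub, rename_X, rename_X] at e
      exact (mul_left_cancel₀ (aux_sub_ne (σ.injective.ne h)) e).symm
  have hRd : ∀ i j, R i j = 0 ∨ (R i j).totalDegree + 2 ≤ P.totalDegree := by
    intro i j
    by_cases h0 : R i j = 0
    · exact Or.inl h0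
    have h : i ≠ j := fun e => h0 (hR0 i j e)
    right
    have e := congrArg totalDegree (hR i j)
    rw [totalDegree_mul_of_isDomain (aux_sub_ne h) h0] at e
    have h1 := aux_sub_deg h
    have h2 := totalDegree_sub (pderiv i P) (pderiv j P)
    have key : ∀ l, (pderiv l P).totalDegree + 1 ≤ P.totalDegree ∨
      (pderiv l P).totalDegree = 0 := fun l => (aux_deg P l).symm.imp_right (by rintro h; simp [h])
    rcases key i with a | a <;> rcases key j with b | b <;> omega
  have hDd : ∀ i, pderiv i (pderiv i P) = 0 ∨
      (pderiv i (pderiv i P)).totalDegree + 2 ≤ P.totalDegree := by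
    intro i
    rcases aux_deg P i with h | h
    · left; simp [h]
    rcases aux_deg (pderiv i P) i with h' | h'
    · exact Or.inl h'
    · right; omega
  refine ⟨C (1/2) * ∑ i, pderiv i (pderiv i P) + C (θ/2) * ∑ i, ∑ j, R i j, ?_, ?_, ?_, ?_⟩
  · intro σ
    simp only [map_add, map_mul, map_sum, rename_C, hRs, ← pderiv_rename σ.injective, hP σ]
    congr 2
    · exact Equiv.sum_comp σ (fun i => pderiv i (pderiv i P))
    · rw [← Equiv.sum_comp σ (fun i => ∑ j, R i j)]
      exact Finset.sum_congr rfl fun i _ => Equiv.sum_comp σ (fun j => R (σ i) j)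
  · have w : ∀ F : MvPolynomial (Fin k) ℝ, (F = 0 ∨ F.totalDegree + 2 ≤ P.totalDegree) →
        F.totalDegree ≤ P.totalDegree - 2 := by
      rintro F (h | h)
      · simp [h]
      · omega
    refine (totalDegree_add _ _).trans (max_le ?_ ?_)
    · rw [C_mul']
      exact (totalDegree_smul_le _ _).trans
        (totalDegree_finsetSum_le fun i _ => w _ (hDd i))
    · rw [C_mul']
      exact (totalDegree_smul_le _ _).trans
        (totalDegree_finsetSum_le fun i _ => totalDegree_finsetSum_le fun j _ => w _ (hRd i j))
  · intro hlt
    have a : ∀ i, pderiv i (pderiv i P) = 0 := fun i => (hDd i).resolve_right (by omega)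
    have b : ∀ i j, R i j = 0 := fun i j => (hRd i j).resolve_right (by omega)
    simp [a, b]
  · intro z hz
    have h1 : ∀ i, pd (fun w => eval w P) i z = eval z (pderiv i P) :=
      fun i => (aux_hasFDeriv P z).2 i
    have h2 : ∀ i, pd2 (fun w => eval w P) i z = eval z (pderiv i (pderiv i P)) := by
      intro i
      unfold pd2
      rw [funext fun w => (aux_hasFDeriv P w).2 i]
      exact (aux_hasFDeriv _ z).2 i
    unfold genA
    simp only [h1, h2, map_add, map_mul, map_sum, eval_C]
    congr 1
    have h3 : ∀ i, ∑ j ∈ univ.erase i, (1 / (z i - z j)) * eval z (pderiv i P)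
        = ∑ j, (1 / (z i - z j)) * eval z (pderiv i P) := by
      intro i
      exact Finset.sum_erase _ (by simp)
    have h4 : ∀ i j, eval z (R i j) = (1 / (z i - z j)) * eval z (pderiv i P)
        + (1 / (z j - z i)) * eval z (pderiv j P) := by
      intro i j
      by_cases h : i = j
      · rw [hR0 i j h]; simp [h]
      · have e := congrArg (eval z) (hR i j)
        simp only [map_sub, map_mul, eval_X] at e
        have n1 : z i - z j ≠ 0 := sub_ne_zero.2 (hz.ne h)
        rw [← neg_sub (z i) (z j), one_div_neg_eq_neg_one_div]
        field_simp
        linarith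
    simp only [h3, h4, Finset.sum_add_distrib]
    rw [Finset.sum_comm (f := fun i j => (1 / (z j - z i)) * eval z (pderiv j P))]
    ring
end
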